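/- Let p > 3 and q be such that 3/p + 2/q = 1. There exists a constant C > 0 such that for all φ ∈ L²(ℝ²): ‖U(t)φ‖_{L^p_t L^q_{x,y}} ≤ C ‖φ‖_{L²(ℝ²)}, where the norm is the L^p norm in time of the L^q(ℝ²) norm in space of the free solution. -/

import Mathlib

noncomputable section

open MeasureTheory Set
open scoped ENNReal NNReal

/-- Japanese bracket `⟨a⟩ = (1+a²)^{1/2}`. -/
def jb (a : ℝ) : ℝ := Real.sqrt (1 + a ^ 2)

/-- `⟨(ξ,η)⟩ = (1+ξ²+η²)^{1/2}`. -/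
def jb2 (ξ η : ℝ) : ℝ := Real.sqrt (1 + ξ ^ 2 + η ^ 2)

/-- Spatial Fourier transform on `ℝ²`. -/
def FT2 (f : ℝ × ℝ → ℂ) (p : ℝ × ℝ) : ℂ :=
  ∫ q : ℝ × ℝ, Complex.exp ((((-2) * Real.pi * (p.1 * q.1 + p.2 * q.2) : ℝ) : ℂ) * Complex.I) * f q

/-- Inverse spatial Fourier transform on `ℝ²`. -/
def IFT2 (f : ℝ × ℝ → ℂ) (p : ℝ × ℝ) : ℂ :=
  ∫ q : ℝ × ℝ, Complex.exp (((2 * Real.pi * (p.1 * q.1 + p.2 * q.2) : ℝ) : ℂ) * Complex.I) * f q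

/-- Space-time Fourier transform on `ℝ³`, variables `(t,x,y) ↦ (τ,ξ,η)`. -/
def FT3 (u : ℝ × ℝ × ℝ → ℂ) (p : ℝ × ℝ × ℝ) : ℂ :=
  ∫ q : ℝ × ℝ × ℝ, Complex.exp ((((-2) * Real.pi *
    (p.1 * q.1 + p.2.1 * q.2.1 + p.2.2 * q.2.2) : ℝ) : ℂ) * Complex.I) * u q

/-- Bourgain norm `‖u‖_{s,b}` with weight `⟨τ-ξ³-η³⟩^b⟨(ξ,η)⟩^s`
(symmetrized Zakharov-Kuznetsov equation). -/
def XN (s b : ℝ) (u : ℝ × ℝ × ℝ → ℂ) : ℝ≥0∞ :=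
  (∫⁻ p : ℝ × ℝ × ℝ,
    ENNReal.ofReal ((jb (p.1 - p.2.1 ^ 3 - p.2.2 ^ 3) ^ b * jb2 p.2.1 p.2.2 ^ s) ^ 2) *
      (‖FT3 u p‖₊ : ℝ≥0∞) ^ 2) ^ (1 / 2 : ℝ)

/-- `H^s(ℝ²)` norm. -/
def HN (s : ℝ) (φ : ℝ × ℝ → ℂ) : ℝ≥0∞ :=
  (∫⁻ q : ℝ × ℝ, ENNReal.ofReal ((jb2 q.1 q.2 ^ s) ^ 2) * (‖FT2 φ q‖₊ : ℝ≥0∞) ^ 2) ^ (1 / 2 : ℝ)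

/-- `L²(ℝ_t × ℝ²_{x,y})` norm. -/
def L2N (u : ℝ × ℝ × ℝ → ℂ) : ℝ≥0∞ :=
  (∫⁻ p : ℝ × ℝ × ℝ, (‖u p‖₊ : ℝ≥0∞) ^ 2) ^ (1 / 2 : ℝ)

/-- `L²(ℝ²)` norm. -/
def L2N2 (φ : ℝ × ℝ → ℂ) : ℝ≥0∞ :=
  (∫⁻ q : ℝ × ℝ, (‖φ q‖₊ : ℝ≥0∞) ^ 2) ^ (1 / 2 : ℝ)

/-- Mixed norm `L^p_t L^q_{x,y}`. -/
def LpLq (p q : ℝ) (u : ℝ × ℝ × ℝ → ℂ) : ℝ≥0∞ :=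
  (∫⁻ t : ℝ, (∫⁻ z : ℝ × ℝ, (‖u (t, z.1, z.2)‖₊ : ℝ≥0∞) ^ q) ^ (p / q)) ^ (1 / p)

/-- The unitary group `U(t) = e^{-t(∂_x³+∂_y³)}`, on the Fourier side
`(U(t)φ)^(ξ,η) = e^{it(ξ³+η³)} φ̂(ξ,η)`. -/
def Ugrp (t : ℝ) (φ : ℝ × ℝ → ℂ) : ℝ × ℝ → ℂ :=
  IFT2 fun q => Complex.exp (((t * (q.1 ^ 3 + q.2 ^ 3) : ℝ) : ℂ) * Complex.I) * FT2 φ q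

/-- Spatial Fourier multiplier operator (acting for each fixed time `t`). -/
def mult2 (m : ℝ × ℝ → ℂ) (u : ℝ × ℝ × ℝ → ℂ) : ℝ × ℝ × ℝ → ℂ :=
  fun p => IFT2 (fun q => m q * FT2 (fun z => u (p.1, z.1, z.2)) q) (p.2.1, p.2.2)

/-- Bilinear operator with symbol `a(ξ₁,ξ₂,η₁,η₂)`, acting for each fixed time `t` by
`(A(f,g))^(ξ,η) = ∫_{ξ=ξ₁+ξ₂, η=η₁+η₂} a f̂(ξ₁,η₁) ĝ(ξ₂,η₂) dξ₁ dη₁`. -/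
def bil (a : ℝ → ℝ → ℝ → ℝ → ℂ) (u v : ℝ × ℝ × ℝ → ℂ) : ℝ × ℝ × ℝ → ℂ :=
  fun p => IFT2 (fun ζ => ∫ w : ℝ × ℝ,
      a w.1 (ζ.1 - w.1) w.2 (ζ.2 - w.2) *
        FT2 (fun z => u (p.1, z.1, z.2)) w *
        FT2 (fun z => v (p.1, z.1, z.2)) (ζ.1 - w.1, ζ.2 - w.2)) (p.2.1, p.2.2)

/-- Symbol of the bilinear operator `I_x^{1/2} I_{x,-}^{1/2}`:
`|ξ₁+ξ₂|^{1/2}|ξ₁-ξ₂|^{1/2}`. -/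
def symIx : ℝ → ℝ → ℝ → ℝ → ℂ := fun ξ₁ ξ₂ _ _ =>
  ((|ξ₁ + ξ₂| ^ (1 / 2 : ℝ) * |ξ₁ - ξ₂| ^ (1 / 2 : ℝ) : ℝ) : ℂ)

/-- Symbol of the bilinear operator `I_y^{1/2} I_{y,-}^{1/2}`:
`|η₁+η₂|^{1/2}|η₁-η₂|^{1/2}`. -/
def symIy : ℝ → ℝ → ℝ → ℝ → ℂ := fun _ _ η₁ η₂ =>
  ((|η₁ + η₂| ^ (1 / 2 : ℝ) * |η₁ - η₂| ^ (1 / 2 : ℝ) : ℝ) : ℂ)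

/-- Sharp Fourier projection in the `y`-variable onto frequencies `η ∈ S`. -/
def PyS (S : Set ℝ) : (ℝ × ℝ × ℝ → ℂ) → ℝ × ℝ × ℝ → ℂ :=
  mult2 fun q => S.indicator (fun _ => (1 : ℂ)) q.2

/-- Dyadic projection `P_{y,k}` onto frequencies `|η| ≤ 2^k`. -/
def Pyk (k : ℤ) : (ℝ × ℝ × ℝ → ℂ) → ℝ × ℝ × ℝ → ℂ :=
  PyS {η : ℝ | |η| ≤ (2 : ℝ) ^ k}

/-- Bessel potential `J_y^s` in the `y`-variable, symbol `⟨η⟩^s`. -/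
def Jy (s : ℝ) : (ℝ × ℝ × ℝ → ℂ) → ℝ × ℝ × ℝ → ℂ :=
  mult2 fun q => ((jb q.2 ^ s : ℝ) : ℂ)

/-- Bessel potential `J_x^s` in the `x`-variable, symbol `⟨ξ⟩^s`. -/
def Jx (s : ℝ) : (ℝ × ℝ × ℝ → ℂ) → ℝ × ℝ × ℝ → ℂ :=
  mult2 fun q => ((jb q.1 ^ s : ℝ) : ℂ)

/-- The operator `∂_x + ∂_y`, with spatial Fourier symbol `i(ξ+η)`. -/
def DxDy : (ℝ × ℝ × ℝ → ℂ) → ℝ × ℝ × ℝ → ℂ :=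
  mult2 fun q => Complex.I * ((q.1 + q.2 : ℝ) : ℂ)

/-- A fixed smooth, even cut-off `ψ ∈ C₀^∞(-2,2)`, `0 ≤ ψ ≤ 1`, `ψ = 1` on `[-1,1]`. -/
def IsCutoff (ψ : ℝ → ℝ) : Prop :=
  ContDiff ℝ (⊤ : ℕ∞) ψ ∧ HasCompactSupport ψ ∧ tsupport ψ ⊆ Set.Ioo (-2) 2 ∧
    (∀ t, ψ (-t) = ψ t) ∧ (∀ t, ψ t ∈ Set.Icc (0 : ℝ) 1) ∧ (∀ t, |t| ≤ 1 → ψ t = 1)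


lemma vdc_parts {c d : ℝ} (hcd : c ≤ d) {g g' : ℝ → ℝ} {F F' : ℝ → ℂ} {B : ℝ}
    (hg : ∀ x ∈ Icc c d, HasDerivAt g (g' x) x) (hF : ∀ x, HasDerivAt F (F' x) x)
    (hg'c : ContinuousOn g' (Icc c d)) (hF'c : Continuous F')
    (hF1 : ∀ x, ‖F x‖ ≤ 1) (hg0 : ∀ x ∈ Icc c d, 0 ≤ g x) (hgB : ∀ x ∈ Icc c d, g x ≤ B)
    (hs : (∀ x ∈ Icc c d, 0 ≤ g' x) ∨ (∀ x ∈ Icc c d, g' x ≤ 0)) :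
    ‖∫ x in c..d, (g x : ℂ) * F' x‖ ≤ 2 * B := by
  have hu : uIcc c d = Icc c d := uIcc_of_le hcd
  have h1 := intervalIntegral.integral_mul_deriv_eq_deriv_mul (a := c) (b := d)
    (u := fun x => (g x : ℂ)) (v := F) (u' := fun x => (g' x : ℂ)) (v' := F')
    (by rw [hu]; intro x hx; exact (hg x hx).ofReal_comp) (fun x _ => hF x)
    (by apply ContinuousOn.intervalIntegrable; rw [hu]
        exact Complex.continuous_ofReal.comp_continuousOn hg'c)
    (hF'c.intervalIntegrable _ _)
  rw [h1]
  have hInteg : IntervalIntegrable g' volume c d := by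
    apply ContinuousOn.intervalIntegrable; rwa [hu]
  have hftc : ∫ x in c..d, g' x = g d - g c :=
    intervalIntegral.integral_eq_sub_of_hasDerivAt (by rw [hu]; exact hg) hInteg
  have hc : c ∈ Icc c d := ⟨le_rfl, hcd⟩
  have hd : d ∈ Icc c d := ⟨hcd, le_rfl⟩
  have habs : ∫ x in c..d, |g' x| ≤ |g d - g c| := by
    rcases hs with hs | hs
    · rw [← hftc]
      refine le_trans (le_of_eq ?_) (le_abs_self _)
      apply intervalIntegral.integral_congr
      intro x hx; rw [hu] at hx; simp [abs_of_nonneg (hs x hx)]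
    · rw [← hftc]
      refine le_trans (le_of_eq ?_) (neg_le_abs _)
      rw [← intervalIntegral.integral_neg]
      apply intervalIntegral.integral_congr
      intro x hx; rw [hu] at hx; simp [abs_of_nonpos (hs x hx)]
  have h2 : ‖∫ x in c..d, (g' x : ℂ) * F x‖ ≤ |g d - g c| := by
    refine le_trans ?_ habs
    apply intervalIntegral.norm_integral_le_of_norm_le hcd _ hInteg.abs
    filter_upwards with x _
    rw [norm_mul, Complex.norm_real, Real.norm_eq_abs]
    exact mul_le_of_le_one_right (abs_nonneg _) (hF1 x)
  have h3 : ‖(g d : ℂ) * F d‖ ≤ g d := by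
    rw [norm_mul, Complex.norm_real, Real.norm_eq_abs, abs_of_nonneg (hg0 d hd)]
    exact mul_le_of_le_one_right (hg0 d hd) (hF1 d)
  have h4 : ‖(g c : ℂ) * F c‖ ≤ g c := by
    rw [norm_mul, Complex.norm_real, Real.norm_eq_abs, abs_of_nonneg (hg0 c hc)]
    exact mul_le_of_le_one_right (hg0 c hc) (hF1 c)
  have h5 : |g d - g c| + g d + g c ≤ 2 * B := by
    have := hgB c hc; have := hgB d hd
    rcases abs_cases (g d - g c) with h | h <;> linarith [hg0 c hc, hg0 d hd]
  calc _ ≤ ‖(g d : ℂ) * F d‖ + ‖(g c : ℂ) * F c‖ + ‖∫ x in c..d, (g' x : ℂ) * F x‖ :=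
        (norm_sub_le _ _).trans (by gcongr; exact norm_sub_le _ _)
    _ ≤ _ := by linarith

/-- cubic phase -/
def cph (t a x : ℝ) : ℂ := Complex.exp (((t * x ^ 3 + a * x : ℝ) : ℂ) * Complex.I)

lemma norm_cph (t a x : ℝ) : ‖cph t a x‖ = 1 := Complex.norm_exp_ofReal_mul_I _

lemma continuous_cph (t a : ℝ) : Continuous (cph t a) := by unfold cph; fun_prop

lemma hasDerivAt_cph (t a x : ℝ) :
    HasDerivAt (cph t a) (((3 * t * x ^ 2 + a : ℝ) : ℂ) * Complex.I * cph t a x) x := by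
  unfold cph
  have h : HasDerivAt (fun x : ℝ => t * x ^ 3 + a * x) (3 * t * x ^ 2 + a) x := by
    have := ((hasDerivAt_pow 3 x).const_mul t).fun_add ((hasDerivAt_id' x).const_mul a)
    refine this.congr_deriv ?_
    norm_num; ring
  have := (h.ofReal_comp.mul_const Complex.I).cexp
  convert this using 1
  ring

lemma vdc_first {t a c d l σ : ℝ} (hσ : σ = 1 ∨ σ = -1) (ht : 0 < t) (hl : 0 < l) (hc : 0 ≤ c)
    (hcd : c ≤ d)
    (h : ∀ x ∈ Icc c d, l ≤ σ * (3 * t * x ^ 2 + a)) :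
    ‖∫ x in c..d, cph t a x‖ ≤ 2 / l := by
  have hne : ∀ x ∈ Icc c d, 3 * t * x ^ 2 + a ≠ 0 := by
    intro x hx h0
    have := h x hx
    rw [h0] at this; linarith
  have key := vdc_parts (c := c) (d := d) (B := 1 / l) hcd
    (g := fun x => σ / (3 * t * x ^ 2 + a))
    (g' := fun x => - σ * (6 * t * x) / (3 * t * x ^ 2 + a) ^ 2)
    (F := cph t a) (F' := fun x => (((3 * t * x ^ 2 + a : ℝ) : ℂ) * Complex.I * cph t a x))
    (by
      intro x hx
      have h1 : HasDerivAt (fun x : ℝ => 3 * t * x ^ 2 + a) (6 * t * x) x := by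
        have := ((hasDerivAt_pow 2 x).const_mul (3 * t)).add_const a
        refine this.congr_deriv ?_
        norm_num; ring
      have := (hasDerivAt_const x σ).fun_div h1 (hne x hx)
      refine this.congr_deriv ?_
      ring)
    (fun x => hasDerivAt_cph t a x)
    (by
      apply ContinuousOn.div (by fun_prop) (by fun_prop)
      intro x hx; exact pow_ne_zero _ (hne x hx))
    (by have := continuous_cph t a; fun_prop)
    (fun x => (norm_cph t a x).le)
    (by
      intro x hx
      have := h x hx
      rcases hσ with rfl | rfl
      · exact div_nonneg (by norm_num) (by linarith)
      · exact div_nonneg_of_nonpos (by norm_num) (by linarith))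
    (by
      intro x hx
      have := h x hx
      rcases hσ with rfl | rfl
      · exact one_div_le_one_div_of_le hl (by linarith)
      · have : (-1) / (3 * t * x ^ 2 + a) = 1 / (-(3 * t * x ^ 2 + a)) := by
          rw [neg_div, ← one_div_neg_eq_neg_one_div]
        rw [this]
        exact one_div_le_one_div_of_le hl (by linarith))
    (by
      rcases hσ with rfl | rfl
      · right; intro x hx
        have : 0 ≤ x := hc.trans hx.1
        apply div_nonpos_of_nonpos_of_nonneg _ (sq_nonneg _)
        have : 0 ≤ t * x := by positivity
        linarith
      · left; intro x hx
        have : 0 ≤ x := hc.trans hx.1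
        apply div_nonneg _ (sq_nonneg _)
        have : 0 ≤ t * x := by positivity
        linarith)
  have hEq : ∫ x in c..d, ((σ / (3 * t * x ^ 2 + a) : ℝ) : ℂ) *
      (((3 * t * x ^ 2 + a : ℝ) : ℂ) * Complex.I * cph t a x) =
      ((σ : ℂ) * Complex.I) * ∫ x in c..d, cph t a x := by
    rw [← intervalIntegral.integral_const_mul]
    apply intervalIntegral.integral_congr
    intro x hx
    rw [uIcc_of_le hcd] at hx
    have : ((3 * t * x ^ 2 + a : ℝ) : ℂ) ≠ 0 := by exact_mod_cast hne x hx
    simp only [Complex.ofReal_div]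
    field_simp
  rw [hEq, norm_mul] at key
  have hn : ‖(σ : ℂ) * Complex.I‖ = 1 := by
    rcases hσ with rfl | rfl <;> simp
  rw [hn, one_mul] at key
  calc _ ≤ _ := key
    _ = _ := by ring

lemma vdc_half {s : ℝ} (a : ℝ) {N : ℝ} (hs : 0 < s) (hN : 0 ≤ N) :
    ‖∫ x in (0:ℝ)..N, cph (s ^ 3) a x‖ ≤ 5 / s := by
  set α := Real.sqrt ((-a - s) / (3 * s ^ 3)) with hα
  set β := Real.sqrt ((-a + s) / (3 * s ^ 3)) with hβ
  have hs3 : 0 < 3 * s ^ 3 := by positivity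
  have hαβ : α ≤ β := by
    apply Real.sqrt_le_sqrt
    gcongr; linarith
  have hα0 : 0 ≤ α := Real.sqrt_nonneg _
  have hdiff : β - α ≤ 1 / s := by
    have h1 : β ^ 2 ≤ α ^ 2 + (1 / s) ^ 2 := by
      have e : (-a + s) / (3 * s ^ 3) = (-a - s) / (3 * s ^ 3) + (2 / 3) * (1 / s) ^ 2 := by
        field_simp; ring
      have hq : 0 ≤ (1 / s) ^ 2 := by positivity
      rcases le_total 0 ((-a + s) / (3 * s ^ 3)) with h | h
      · rw [hβ, Real.sq_sqrt h, e]
        rcases le_total 0 ((-a - s) / (3 * s ^ 3)) with h' | h'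
        · rw [hα, Real.sq_sqrt h']; linarith
        · nlinarith [sq_nonneg α]
      · rw [hβ, Real.sqrt_eq_zero_of_nonpos h]
        nlinarith [sq_nonneg α]
    have : 0 < 1 / s := by positivity
    by_contra hcon
    push Not at hcon
    nlinarith
  have hi : ∀ u v, IntervalIntegrable (cph (s ^ 3) a) volume u v :=
    fun u v => (continuous_cph _ _).intervalIntegrable _ _
  have hsplit : ∫ x in (0:ℝ)..N, cph (s ^ 3) a x =
      (∫ x in (0:ℝ)..(min α N), cph (s ^ 3) a x) + (∫ x in (min α N)..(min β N), cph (s ^ 3) a x)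
      + ∫ x in (min β N)..N, cph (s ^ 3) a x := by
    rw [intervalIntegral.integral_add_adjacent_intervals (hi _ _) (hi _ _),
      intervalIntegral.integral_add_adjacent_intervals (hi _ _) (hi _ _)]
  have b1 : ‖∫ x in (0:ℝ)..(min α N), cph (s ^ 3) a x‖ ≤ 2 / s := by
    rcases le_or_gt ((-a - s) / (3 * s ^ 3)) 0 with h | h
    · have : α = 0 := Real.sqrt_eq_zero_of_nonpos h
      rw [this, min_eq_left hN]; simp; positivity
    · refine vdc_first (σ := -1) (Or.inr rfl) (by positivity) hs le_rfl (le_min hα0 hN) ?_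
      intro x hx
      have hx2 : x ^ 2 ≤ α ^ 2 := by
        apply pow_le_pow_left₀ hx.1 (hx.2.trans (min_le_left _ _))
      rw [hα, Real.sq_sqrt h.le, le_div_iff₀ hs3] at hx2
      nlinarith
  have b3 : ‖∫ x in (min β N)..N, cph (s ^ 3) a x‖ ≤ 2 / s := by
    rcases le_total N β with h | h
    · rw [min_eq_right h]; simp; positivity
    · rw [min_eq_left h]
      refine vdc_first (σ := 1) (Or.inl rfl) (by positivity) hs (hα0.trans hαβ) h ?_
      intro x hx
      have hx2 : β ^ 2 ≤ x ^ 2 := by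
        apply pow_le_pow_left₀ (hα0.trans hαβ) hx.1
      have : (-a + s) / (3 * s ^ 3) ≤ β ^ 2 := by
        rcases le_total 0 ((-a + s) / (3 * s ^ 3)) with h0 | h0
        · rw [hβ, Real.sq_sqrt h0]
        · exact h0.trans (sq_nonneg _)
      have := this.trans hx2
      rw [div_le_iff₀ hs3] at this
      nlinarith
  have b2 : ‖∫ x in (min α N)..(min β N), cph (s ^ 3) a x‖ ≤ 1 / s := by
    have := intervalIntegral.norm_integral_le_of_norm_le_const (a := min α N) (b := min β N)
      (f := cph (s ^ 3) a) (C := 1) (fun x _ => (norm_cph _ _ x).le)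
    refine this.trans ?_
    rw [one_mul, abs_of_nonneg (by linarith [min_le_min_right N hαβ])]
    refine le_trans ?_ hdiff
    rcases le_total α N with h1 | h1 <;> rcases le_total β N with h2 | h2 <;>
      simp [h1, h2] <;> linarith
  rw [hsplit]
  calc _ ≤ 2 / s + 1 / s + 2 / s := (norm_add₃_le).trans (by linarith)
    _ = 5 / s := by ring

lemma vdc_full_pos {s : ℝ} (a : ℝ) {N : ℝ} (hs : 0 < s) (hN : 0 ≤ N) :
    ‖∫ x in (-N)..N, cph (s ^ 3) a x‖ ≤ 10 / s := by
  have hi : ∀ u v, IntervalIntegrable (cph (s ^ 3) a) volume u v :=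
    fun u v => (continuous_cph _ _).intervalIntegrable _ _
  rw [← intervalIntegral.integral_add_adjacent_intervals (hi (-N) 0) (hi 0 N)]
  have h1 : ∫ x in (-N)..0, cph (s ^ 3) a x =
      starRingEnd ℂ (∫ x in (0:ℝ)..N, cph (s ^ 3) a x) := by
    have e := intervalIntegral.integral_comp_neg (a := 0) (b := N) (fun x => cph (s ^ 3) a x)
    rw [neg_zero] at e
    rw [← e, intervalIntegral.integral_of_le hN, intervalIntegral.integral_of_le hN,
      ← integral_conj]
    congr 1; ext x
    simp only [cph]
    rw [← Complex.exp_conj]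
    congr 1
    simp; ring
  calc _ ≤ 5 / s + 5 / s := by
        refine (norm_add_le _ _).trans (add_le_add ?_ (vdc_half a hs hN))
        rw [h1, RCLike.norm_conj]
        exact vdc_half a hs hN
    _ = _ := by ring

lemma vdc_full (t a : ℝ) {N : ℝ} (ht : t ≠ 0) (hN : 0 ≤ N) :
    ‖∫ x in (-N)..N, cph t a x‖ ≤ 10 * |t| ^ (-(1/3) : ℝ) := by
  have hat : 0 < |t| := abs_pos.mpr ht
  have hs : 0 < |t| ^ (1/3 : ℝ) := Real.rpow_pos_of_pos hat _
  have hs3 : (|t| ^ (1/3 : ℝ)) ^ 3 = |t| := by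
    rw [← Real.rpow_natCast, ← Real.rpow_mul hat.le]; norm_num
  have e : (10:ℝ) * |t| ^ (-(1/3) : ℝ) = 10 / |t| ^ (1/3 : ℝ) := by
    rw [Real.rpow_neg hat.le]; rfl
  rw [e]
  rcases lt_or_gt_of_ne ht with h | h
  · have := vdc_full_pos (s := |t| ^ (1/3 : ℝ)) (-a) hs hN
    rw [hs3, abs_of_neg h] at this
    have e2 := intervalIntegral.integral_comp_neg (a := -N) (b := N) (fun x => cph t a x)
    rw [neg_neg] at e2
    rw [← e2, abs_of_neg h]
    convert this using 4 with x
    simp only [cph]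
    congr 3; ring
  · have := vdc_full_pos (s := |t| ^ (1/3 : ℝ)) a hs hN
    rw [hs3, abs_of_pos h] at this
    rwa [abs_of_pos h]

/-- character -/
def ee (p q : ℝ × ℝ) : ℂ := Complex.exp (((2 * Real.pi * (p.1 * q.1 + p.2 * q.2) : ℝ) : ℂ) * Complex.I)

lemma norm_ee (p q : ℝ × ℝ) : ‖ee p q‖ = 1 := Complex.norm_exp_ofReal_mul_I _

lemma continuous_ee : Continuous (fun x : (ℝ × ℝ) × (ℝ × ℝ) => ee x.1 x.2) := by
  unfold ee; fun_prop

lemma continuous_ee_right (p : ℝ × ℝ) : Continuous (fun q => ee p q) := by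
  unfold ee; fun_prop

lemma IFT2_eq (f : ℝ × ℝ → ℂ) (p : ℝ × ℝ) : IFT2 f p = ∫ q, ee p q * f q := rfl

lemma FT2_eq_IFT2 (f : ℝ × ℝ → ℂ) (p : ℝ × ℝ) : FT2 f p = IFT2 f (-p) := by
  unfold FT2 IFT2
  congr 1; ext q; congr 3; simp; ring

lemma ee_comm (p q : ℝ × ℝ) : ee p q = ee q p := by
  unfold ee; congr 3; ring

lemma ee_neg (p q : ℝ × ℝ) : ee (-p) q = starRingEnd ℂ (ee p q) := by
  unfold ee
  rw [← Complex.exp_conj, map_mul, Complex.conj_ofReal, Complex.conj_I]; congr 1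
  simp only [Prod.fst_neg, Prod.snd_neg]; push_cast; ring

lemma ee_add (p p' q : ℝ × ℝ) : ee (p + p') q = ee p q * ee p' q := by
  unfold ee
  rw [← Complex.exp_add]; congr 1; simp; ring

lemma norm_IFT2_le (f : ℝ × ℝ → ℂ) (p : ℝ × ℝ) : ‖IFT2 f p‖ ≤ ∫ q, ‖f q‖ := by
  rw [IFT2_eq]
  refine (norm_integral_le_integral_norm _).trans (le_of_eq ?_)
  congr 1; ext q; rw [norm_mul, norm_ee, one_mul]

lemma integrable_ee_mul {f : ℝ × ℝ → ℂ} (hf : Integrable f) (p : ℝ × ℝ) :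
    Integrable (fun q => ee p q * f q) :=
  hf.bdd_mul (c := 1) (continuous_ee_right p).aestronglyMeasurable
    (Filter.Eventually.of_forall fun q => (norm_ee p q).le)

lemma continuous_IFT2 {f : ℝ × ℝ → ℂ} (hf : Integrable f) : Continuous (IFT2 f) := by
  have : IFT2 f = fun p => ∫ q, ee p q * f q := rfl
  rw [this]
  apply continuous_of_dominated (bound := fun q => ‖f q‖)
  · intro p; exact (integrable_ee_mul hf p).aestronglyMeasurable
  · intro p; filter_upwards with q; rw [norm_mul, norm_ee, one_mul]
  · exact hf.norm
  · filter_upwards with q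
    have : Continuous fun p => ee p q := by simp_rw [ee_comm _ q]; exact continuous_ee_right q
    fun_prop

lemma continuous_FT2 {f : ℝ × ℝ → ℂ} (hf : Integrable f) : Continuous (FT2 f) := by
  have : FT2 f = fun p => IFT2 f (-p) := funext (FT2_eq_IFT2 f)
  rw [this]
  exact (continuous_IFT2 hf).comp continuous_neg

lemma integrable_mul_IFT2 {m f : ℝ × ℝ → ℂ} (hm : Integrable m) (hf : Integrable f) :
    Integrable (fun p => m p * IFT2 f p) :=
  hm.mul_bdd (c := ∫ q, ‖f q‖) (continuous_IFT2 hf).aestronglyMeasurable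
    (Filter.Eventually.of_forall fun q => norm_IFT2_le f q)

lemma integrable_kernel {m f : ℝ × ℝ → ℂ} (hm : Integrable m) (hf : Integrable f)
    {k : (ℝ × ℝ) × (ℝ × ℝ) → ℂ} (hk : Continuous k) (hk1 : ∀ x, ‖k x‖ ≤ 1) :
    Integrable (fun x : (ℝ × ℝ) × (ℝ × ℝ) => k x * (m x.1 * f x.2)) :=
  (hm.mul_prod hf).bdd_mul (c := 1) hk.aestronglyMeasurable
    (Filter.Eventually.of_forall hk1)

/-- Parseval-type identity. -/
lemma parseval_IFT2 {M f : ℝ × ℝ → ℂ} (hM : Integrable M) (hf : Integrable f) :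
    ∫ p, M p * starRingEnd ℂ (IFT2 f p) = ∫ w, starRingEnd ℂ (f w) * FT2 M w := by
  have hf' : Integrable (fun w => starRingEnd ℂ (f w)) := by
    refine hf.norm.mono' (Complex.continuous_conj.comp_aestronglyMeasurable hf.1) ?_
    filter_upwards with w; simp
  have hsw := integral_integral_swap (f := fun p w => ee (-p) w * (M p * starRingEnd ℂ (f w)))
    (μ := (volume : Measure (ℝ × ℝ))) (ν := (volume : Measure (ℝ × ℝ)))
    (integrable_kernel hM hf' (k := fun x => ee (-x.1) x.2)
      (continuous_ee.comp (by fun_prop : Continuous fun x : (ℝ × ℝ) × (ℝ × ℝ) => (-x.1, x.2)))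
      (fun x => (norm_ee _ _).le))
  calc ∫ p, M p * starRingEnd ℂ (IFT2 f p)
      = ∫ p, ∫ w, ee (-p) w * (M p * starRingEnd ℂ (f w)) := by
        congr 1; ext p
        rw [IFT2_eq, ← integral_conj, ← integral_const_mul]
        congr 1; ext w
        rw [ee_neg, map_mul]; ring
    _ = _ := hsw
    _ = _ := by
        congr 1; ext w
        rw [FT2_eq_IFT2, IFT2_eq, ← integral_const_mul]
        congr 1; ext p
        rw [ee_neg, ee_neg, ee_comm p w]; ring

lemma FT2_mul_IFT2 {m f : ℝ × ℝ → ℂ} (hm : Integrable m) (hf : Integrable f) (w : ℝ × ℝ) :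
    FT2 (fun p => m p * IFT2 f p) w = ∫ z, f z * IFT2 m (z - w) := by
  have hsw := integral_integral_swap (f := fun p z => ee (z - w) p * (m p * f z))
    (μ := (volume : Measure (ℝ × ℝ))) (ν := (volume : Measure (ℝ × ℝ)))
    (integrable_kernel hm hf (k := fun x => ee (x.2 - w) x.1)
      (continuous_ee.comp (by fun_prop : Continuous fun x : (ℝ × ℝ) × (ℝ × ℝ) => (x.2 - w, x.1)))
      (fun x => (norm_ee _ _).le))
  calc FT2 (fun p => m p * IFT2 f p) w
      = ∫ p, ∫ z, ee (z - w) p * (m p * f z) := by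
        rw [FT2_eq_IFT2, IFT2_eq]
        congr 1; ext p
        rw [IFT2_eq, ← integral_const_mul, ← integral_const_mul]
        congr 1; ext z
        rw [sub_eq_add_neg, ee_add, ee_comm p z]; ring
    _ = _ := hsw
    _ = _ := by
        congr 1; ext z
        rw [IFT2_eq, ← integral_const_mul]
        congr 1; ext p
        ring

/-- Gaussian weight -/
def gw (δ : ℝ) (p : ℝ × ℝ) : ℝ := Real.exp (-δ * p.1 ^ 2) * Real.exp (-δ * p.2 ^ 2)

lemma integrable_gw {δ : ℝ} (hδ : 0 < δ) : Integrable (gw δ) :=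
  (integrable_exp_neg_mul_sq hδ).mul_prod (integrable_exp_neg_mul_sq hδ)

lemma IFT2_gw {δ : ℝ} (hδ : 0 < δ) (z : ℝ × ℝ) :
    IFT2 (fun p => (gw δ p : ℂ)) z = ((Real.pi / δ * gw (Real.pi ^ 2 / δ) z : ℝ) : ℂ) := by
  have h1 : ∀ a : ℝ, ∫ x : ℝ, Complex.exp (Complex.I * ((2 * Real.pi * a : ℝ):ℂ) * x) *
      Complex.exp (-(δ : ℂ) * x ^ 2) =
      ((Real.sqrt (Real.pi / δ) * Real.exp (-(Real.pi ^ 2 / δ) * a ^ 2) : ℝ) : ℂ) := by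
    intro a
    rw [fourierIntegral_gaussian (by simpa using hδ)]
    rw [Real.sqrt_eq_rpow, Complex.ofReal_mul (_ ^ _), Complex.ofReal_cpow (by positivity),
      Complex.ofReal_exp]
    congr 1
    · push_cast; norm_num
    · congr 1; push_cast
      have : (δ : ℂ) ≠ 0 := by exact_mod_cast hδ.ne'
      field_simp; ring
  have h2 : IFT2 (fun p => (gw δ p : ℂ)) z = ∫ p : ℝ × ℝ,
      (Complex.exp (Complex.I * ((2 * Real.pi * z.1 : ℝ):ℂ) * p.1) *
      Complex.exp (-(δ : ℂ) * p.1 ^ 2)) * (Complex.exp (Complex.I * ((2 * Real.pi * z.2 : ℝ):ℂ) * p.2) *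
      Complex.exp (-(δ : ℂ) * p.2 ^ 2)) := by
    rw [IFT2_eq]; congr 1; ext p
    simp only [ee, gw]
    push_cast
    simp only [← Complex.exp_add]
    congr 1; ring
  rw [h2]
  have h3 := integral_prod_mul (μ := (volume : Measure ℝ)) (ν := (volume : Measure ℝ))
    (fun x : ℝ => Complex.exp (Complex.I * ((2 * Real.pi * z.1 : ℝ):ℂ) * x) *
      Complex.exp (-(δ : ℂ) * x ^ 2)) (fun x : ℝ => Complex.exp (Complex.I * ((2 * Real.pi * z.2 : ℝ):ℂ) * x) *
      Complex.exp (-(δ : ℂ) * x ^ 2))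
  rw [Measure.volume_eq_prod, h3, h1, h1, ← Complex.ofReal_mul]
  congr 1
  unfold gw
  have : Real.sqrt (Real.pi / δ) * Real.sqrt (Real.pi / δ) = Real.pi / δ :=
    Real.mul_self_sqrt (by positivity)
  calc _ = (Real.sqrt (Real.pi / δ) * Real.sqrt (Real.pi / δ)) * (Real.exp (-(Real.pi ^ 2 / δ) * z.1 ^ 2) * Real.exp (-(Real.pi ^ 2 / δ) * z.2 ^ 2)) := by ring
    _ = _ := by rw [this]

lemma lintegral_IFT2_gw {δ : ℝ} (hδ : 0 < δ) :
    ∫⁻ z, ‖IFT2 (fun p => (gw δ p : ℂ)) z‖ₑ = 1 := by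
  have hb : 0 < Real.pi ^ 2 / δ := by positivity
  have hnn : ∀ z, 0 ≤ Real.pi / δ * gw (Real.pi ^ 2 / δ) z := by
    intro z; unfold gw; positivity
  have e : ∀ z, ‖IFT2 (fun p => (gw δ p : ℂ)) z‖ₑ =
      ENNReal.ofReal (Real.pi / δ * gw (Real.pi ^ 2 / δ) z) := by
    intro z
    rw [IFT2_gw hδ, ← ofReal_norm, Complex.norm_real, Real.norm_eq_abs, abs_of_nonneg (hnn z)]
  simp_rw [e]
  rw [← ofReal_integral_eq_lintegral_ofReal ((integrable_gw hb).const_mul _)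
    (Filter.Eventually.of_forall hnn), integral_const_mul]
  have h3 := integral_prod_mul (μ := (volume : Measure ℝ)) (ν := (volume : Measure ℝ))
    (fun x : ℝ => Real.exp (-(Real.pi ^ 2 / δ) * x ^ 2)) (fun x : ℝ => Real.exp (-(Real.pi ^ 2 / δ) * x ^ 2))
  have h4 : ∫ a, gw (Real.pi ^ 2 / δ) a = Real.sqrt (Real.pi / (Real.pi ^ 2 / δ)) * Real.sqrt (Real.pi / (Real.pi ^ 2 / δ)) := by
    rw [← integral_gaussian, ← h3]; rfl
  rw [h4, Real.mul_self_sqrt (by positivity)]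
  have : Real.pi ≠ 0 := Real.pi_ne_zero
  rw [← ENNReal.ofReal_one]; congr 1
  field_simp

lemma planch_gauss {f : ℝ × ℝ → ℂ} (hf : Integrable f) {δ : ℝ} (hδ : 0 < δ) :
    ∫⁻ p, ‖IFT2 f p‖ₑ ^ 2 * ENNReal.ofReal (gw δ p) ≤ ∫⁻ q, ‖f q‖ₑ ^ 2 := by
  have hg : Integrable (fun p => (gw δ p : ℂ)) := (integrable_gw hδ).ofReal
  have hM := integrable_mul_IFT2 hg hf
  have h1 := parseval_IFT2 hM hf
  have hgc : Continuous (IFT2 (fun p => (gw δ p : ℂ))) := continuous_IFT2 hg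
  have hgn : ∀ p, 0 ≤ gw δ p := fun p => by unfold gw; positivity
  have hL : ∫⁻ p, ‖IFT2 f p‖ₑ ^ 2 * ENNReal.ofReal (gw δ p) =
      ‖∫ p, (gw δ p : ℂ) * IFT2 f p * starRingEnd ℂ (IFT2 f p)‖ₑ := by
    have hi : Integrable (fun p => gw δ p * ‖IFT2 f p‖ ^ 2) := by
      refine (integrable_gw hδ).mul_bdd (c := (∫ q, ‖f q‖) ^ 2)
        ((continuous_IFT2 hf).norm.pow 2).aestronglyMeasurable
        (Filter.Eventually.of_forall fun q => ?_)
      rw [norm_pow, norm_norm]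
      exact pow_le_pow_left₀ (norm_nonneg _) (norm_IFT2_le f q) 2
    have e : ∀ p, (gw δ p : ℂ) * IFT2 f p * starRingEnd ℂ (IFT2 f p) =
        ((gw δ p * ‖IFT2 f p‖ ^ 2 : ℝ) : ℂ) := by
      intro p
      rw [mul_assoc, Complex.mul_conj, Complex.normSq_eq_norm_sq]; push_cast; rfl
    simp_rw [e]
    rw [integral_complex_ofReal, ← ofReal_norm, Complex.norm_real, Real.norm_eq_abs,
      abs_of_nonneg (integral_nonneg fun p => mul_nonneg (hgn p) (sq_nonneg _)),
      ofReal_integral_eq_lintegral_ofReal hi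
        (Filter.Eventually.of_forall fun p => mul_nonneg (hgn p) (sq_nonneg _))]
    congr 1; ext p
    rw [ENNReal.ofReal_mul (hgn p), ENNReal.ofReal_pow (norm_nonneg _), ofReal_norm,
      mul_comm]
  set H : ℝ × ℝ → ℝ≥0∞ := fun z => ‖IFT2 (fun p => (gw δ p : ℂ)) z‖ₑ with hH
  have hHm : Measurable H := hgc.measurable.enorm
  have hH1 : ∫⁻ z, H z = 1 := lintegral_IFT2_gw hδ
  have hfm : AEMeasurable (fun x => ‖f x‖ₑ) := hf.1.enorm
  rw [hL, h1]
  have hstep : ∀ w, ‖starRingEnd ℂ (f w) * FT2 (fun p => (gw δ p : ℂ) * IFT2 f p) w‖ₑ ≤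
      ∫⁻ z, (‖f w‖ₑ ^ 2 * H (z - w) + ‖f z‖ₑ ^ 2 * H (z - w)) / 2 := by
    intro w
    rw [FT2_mul_IFT2 hg hf, enorm_mul]
    have hc : ‖starRingEnd ℂ (f w)‖ₑ = ‖f w‖ₑ := by
      rw [← ofReal_norm, RCLike.norm_conj, ofReal_norm]
    rw [hc]
    calc _ ≤ ‖f w‖ₑ * ∫⁻ z, ‖f z * IFT2 (fun p => (gw δ p : ℂ)) (z - w)‖ₑ := by
          gcongr; exact enorm_integral_le_lintegral_enorm _
      _ = ∫⁻ z, ‖f w‖ₑ * ‖f z * IFT2 (fun p => (gw δ p : ℂ)) (z - w)‖ₑ := by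
          rw [lintegral_const_mul' _ _ enorm_ne_top]
      _ ≤ _ := by
          apply lintegral_mono; intro z
          simp only [enorm_mul]
          have hab : ∀ a b : ℂ, ‖a‖ₑ * ‖b‖ₑ ≤ (‖a‖ₑ ^ 2 + ‖b‖ₑ ^ 2) / 2 := by
            intro a b
            rw [ENNReal.le_div_iff_mul_le (by simp) (by simp)]
            simp only [enorm_eq_nnnorm]
            norm_cast
            rw [← NNReal.coe_le_coe]; push_cast
            nlinarith [sq_nonneg (‖a‖ - ‖b‖)]
          calc ‖f w‖ₑ * (‖f z‖ₑ * H (z - w)) = (‖f w‖ₑ * ‖f z‖ₑ) * H (z - w) := by ring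
            _ ≤ ((‖f w‖ₑ ^ 2 + ‖f z‖ₑ ^ 2) / 2) * H (z - w) := by gcongr; exact hab _ _
            _ = _ := by simp only [div_eq_mul_inv]; ring
  have hfc : AEMeasurable (fun x : (ℝ × ℝ) × (ℝ × ℝ) => ‖f x.1‖ₑ ^ 2 * H (x.2 - x.1))
      (volume.prod volume) := by
    apply AEMeasurable.fun_mul
    · exact (hfm.comp_quasiMeasurePreserving Measure.quasiMeasurePreserving_fst).pow_const 2
    · exact (hHm.comp (by fun_prop)).aemeasurable
  have hfc2 : AEMeasurable (fun x : (ℝ × ℝ) × (ℝ × ℝ) => ‖f x.2‖ₑ ^ 2 * H (x.2 - x.1))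
      (volume.prod volume) := by
    apply AEMeasurable.fun_mul
    · exact (hfm.comp_quasiMeasurePreserving Measure.quasiMeasurePreserving_snd).pow_const 2
    · exact (hHm.comp (by fun_prop)).aemeasurable
  have i1 : ∫⁻ w, ∫⁻ z, ‖f w‖ₑ ^ 2 * H (z - w) = ∫⁻ q, ‖f q‖ₑ ^ 2 := by
    congr 1; ext w
    rw [lintegral_const_mul' _ _ (by simp), lintegral_sub_right_eq_self H w, hH1, mul_one]
  have i2 : ∫⁻ w, ∫⁻ z, ‖f z‖ₑ ^ 2 * H (z - w) = ∫⁻ q, ‖f q‖ₑ ^ 2 := by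
    rw [lintegral_lintegral_swap hfc2]
    congr 1; ext z
    rw [lintegral_const_mul' _ _ (by simp), lintegral_sub_left_eq_self H z, hH1, mul_one]
  calc _ ≤ ∫⁻ w, ‖starRingEnd ℂ (f w) * FT2 (fun p => (gw δ p : ℂ) * IFT2 f p) w‖ₑ :=
        enorm_integral_le_lintegral_enorm _
    _ ≤ ∫⁻ w, ∫⁻ z, (‖f w‖ₑ ^ 2 * H (z - w) + ‖f z‖ₑ ^ 2 * H (z - w)) / 2 :=
        lintegral_mono hstep
    _ = ∫⁻ x : (ℝ × ℝ) × (ℝ × ℝ), (‖f x.1‖ₑ ^ 2 * H (x.2 - x.1) + ‖f x.2‖ₑ ^ 2 * H (x.2 - x.1)) / 2 ∂(volume.prod volume) := by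
        rw [lintegral_prod _ ((hfc.fun_add hfc2).div_const 2)]
    _ = ((∫⁻ q, ‖f q‖ₑ ^ 2) + ∫⁻ q, ‖f q‖ₑ ^ 2) / 2 := by
        simp only [div_eq_mul_inv]
        rw [lintegral_mul_const' _ _ (by simp), lintegral_add_left' hfc, lintegral_prod _ hfc,
          lintegral_prod _ hfc2, i1, i2]
    _ = _ := by rw [← mul_two, ENNReal.mul_div_cancel_right (by simp) (by simp)]

lemma planch_IFT2 {f : ℝ × ℝ → ℂ} (hf : Integrable f) :
    ∫⁻ p, ‖IFT2 f p‖ₑ ^ 2 ≤ ∫⁻ q, ‖f q‖ₑ ^ 2 := by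
  have hlim : ∀ p, Filter.Tendsto (fun n : ℕ => ‖IFT2 f p‖ₑ ^ 2 * ENNReal.ofReal (gw (1 / ((n : ℝ) + 1)) p))
      Filter.atTop (nhds (‖IFT2 f p‖ₑ ^ 2)) := by
    intro p
    have hc : Continuous fun δ : ℝ => gw δ p := by unfold gw; fun_prop
    have h1 := (hc.tendsto 0).comp (tendsto_one_div_add_atTop_nhds_zero_nat (𝕜 := ℝ))
    have h2 := ENNReal.Tendsto.const_mul (a := ‖IFT2 f p‖ₑ ^ 2) (ENNReal.tendsto_ofReal h1)
      (Or.inr (by simp))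
    simpa [gw] using h2
  calc ∫⁻ p, ‖IFT2 f p‖ₑ ^ 2 = ∫⁻ p, Filter.liminf (fun n : ℕ => ‖IFT2 f p‖ₑ ^ 2 *
        ENNReal.ofReal (gw (1 / ((n : ℝ) + 1)) p)) Filter.atTop := by
        congr 1; ext p; exact (hlim p).liminf_eq.symm
    _ ≤ Filter.liminf (fun n : ℕ => ∫⁻ p, ‖IFT2 f p‖ₑ ^ 2 *
        ENNReal.ofReal (gw (1 / ((n : ℝ) + 1)) p)) Filter.atTop := by
        apply lintegral_liminf_le
        intro n
        have : Measurable (gw (1 / ((n : ℝ) + 1))) := by unfold gw; fun_prop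
        exact ((continuous_IFT2 hf).measurable.enorm.pow_const 2).mul this.ennreal_ofReal
    _ ≤ _ := by
        refine Filter.liminf_le_of_le (by isBoundedDefault) ?_
        intro b hb
        obtain ⟨n, hn⟩ := hb.exists
        exact hn.trans (planch_gauss hf (by positivity))

lemma planch_FT2 {f : ℝ × ℝ → ℂ} (hf : Integrable f) :
    ∫⁻ p, ‖FT2 f p‖ₑ ^ 2 ≤ ∫⁻ q, ‖f q‖ₑ ^ 2 := by
  have : ∫⁻ p, ‖FT2 f p‖ₑ ^ 2 = ∫⁻ p, ‖IFT2 f p‖ₑ ^ 2 := by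
    simp_rw [FT2_eq_IFT2]
    exact lintegral_neg_eq_self (fun p => ‖IFT2 f p‖ₑ ^ 2)
  rw [this]; exact planch_IFT2 hf

lemma enorm_rpow_eq (a : ℂ) {r : ℝ} (hr : 0 ≤ r) : ‖a‖ₑ ^ r = ENNReal.ofReal (‖a‖ ^ r) := by
  rw [← ofReal_norm, ENNReal.ofReal_rpow_of_nonneg (norm_nonneg _) hr]

lemma enorm_sq_eq (a : ℂ) : ‖a‖ₑ ^ 2 = ENNReal.ofReal (‖a‖ ^ 2) := by
  rw [← ofReal_norm, ENNReal.ofReal_pow (norm_nonneg _)]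

/-- bundle of hypotheses for the interpolation -/
structure DispOp (T : (ℝ × ℝ → ℂ) → (ℝ × ℝ → ℂ)) (A : ℝ) : Prop where
  pos : 0 < A
  meas : ∀ f, Integrable f → Measurable (T f)
  add : ∀ f g, Integrable f → Integrable g → ∀ w, T (fun z => f z + g z) w = T f w + T g w
  one : ∀ f, Integrable f → ∀ w, ‖T f w‖ₑ ≤ ENNReal.ofReal A * ∫⁻ z, ‖f z‖ₑ
  two : ∀ f, Integrable f → ∫⁻ w, ‖T f w‖ₑ ^ 2 ≤ ∫⁻ z, ‖f z‖ₑ ^ 2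

lemma marc_level {T : (ℝ × ℝ → ℂ) → (ℝ × ℝ → ℂ)} {A : ℝ} (hT : DispOp T A) {r : ℝ} (hr : 0 < r)
    {f : ℝ × ℝ → ℂ} (hf : Integrable f) (hfm : Measurable f) {N : ℝ} (hN : 0 < N)
    (hfN : ∫⁻ z, ‖f z‖ₑ ^ (r + 1) ≤ ENNReal.ofReal N) {l : ℝ} (hl : 0 < l) :
    volume {w | l < ‖T f w‖} ≤ ENNReal.ofReal (4 / l ^ 2) *
      ∫⁻ z, {z | l * ‖f z‖ ^ r ≤ 2 * A * N}.indicator (fun z => ‖f z‖ₑ ^ 2) z := by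
  have hA := hT.pos
  set S : Set (ℝ × ℝ) := {z | l * ‖f z‖ ^ r ≤ 2 * A * N} with hS
  have hSm : MeasurableSet S := by
    apply measurableSet_le _ measurable_const
    exact (hfm.norm.pow_const r).const_mul l
  set f1 := S.indicator f with hf1
  set f2 := Sᶜ.indicator f with hf2
  have hi1 : Integrable f1 := hf.indicator hSm
  have hi2 : Integrable f2 := hf.indicator hSm.compl
  have hsum : f = fun z => f1 z + f2 z := by
    ext z; exact (congrFun (indicator_self_add_compl S f) z).symm
  have hb2 : ∫⁻ z, ‖f2 z‖ₑ ≤ ENNReal.ofReal (l / (2 * A)) := by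
    calc ∫⁻ z, ‖f2 z‖ₑ ≤ ∫⁻ z, ENNReal.ofReal (l / (2 * A * N)) * ‖f z‖ₑ ^ (r + 1) := by
          apply lintegral_mono; intro z
          simp only [hf2]
          by_cases hz : z ∈ S
          · simp [hz]
          · rw [indicator_of_mem (by exact hz)]
            rw [enorm_rpow_eq _ (by linarith), ← ENNReal.ofReal_mul (by positivity), ← ofReal_norm]
            apply ENNReal.ofReal_le_ofReal
            have hz' : 2 * A * N < l * ‖f z‖ ^ r := not_le.mp hz
            rw [Real.rpow_add_one' (norm_nonneg _) (by linarith)]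
            rw [div_mul_eq_mul_div, le_div_iff₀ (by positivity)]
            have := norm_nonneg (f z)
            nlinarith
      _ = ENNReal.ofReal (l / (2 * A * N)) * ∫⁻ z, ‖f z‖ₑ ^ (r + 1) := by
          rw [lintegral_const_mul' _ _ ENNReal.ofReal_ne_top]
      _ ≤ ENNReal.ofReal (l / (2 * A * N)) * ENNReal.ofReal N := by gcongr
      _ = _ := by
          rw [← ENNReal.ofReal_mul (by positivity)]; congr 1; field_simp
  have hT2 : ∀ w, ‖T f2 w‖ ≤ l / 2 := by
    intro w
    have h := (hT.one f2 hi2 w).trans (mul_le_mul_right hb2 _)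
    rw [← ENNReal.ofReal_mul hA.le, ← ofReal_norm,
      ENNReal.ofReal_le_ofReal_iff (by positivity)] at h
    refine h.trans (le_of_eq ?_)
    field_simp
  have hsub : {w | l < ‖T f w‖} ⊆ {w | ENNReal.ofReal ((l / 2) ^ 2) ≤ ‖T f1 w‖ₑ ^ 2} := by
    intro w hw
    have hw' : l < ‖T f w‖ := hw
    rw [hsum, hT.add f1 f2 hi1 hi2 w] at hw'
    have h1 := (norm_add_le (T f1 w) (T f2 w))
    have h2 := hT2 w
    simp only [mem_ofPred_eq]
    rw [enorm_sq_eq]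
    apply ENNReal.ofReal_le_ofReal
    apply pow_le_pow_left₀ (by positivity)
    linarith
  have hch := mul_meas_ge_le_lintegral₀ (μ := (volume : Measure (ℝ × ℝ)))
    (f := fun w => ‖T f1 w‖ₑ ^ 2)
    ((hT.meas f1 hi1).enorm.pow_const 2).aemeasurable (ENNReal.ofReal ((l / 2) ^ 2))
  have hcoef : ENNReal.ofReal (4 / l ^ 2) * ENNReal.ofReal ((l / 2) ^ 2) = 1 := by
    rw [← ENNReal.ofReal_mul (by positivity), ← ENNReal.ofReal_one]
    congr 1; field_simp; ring
  calc volume {w | l < ‖T f w‖}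
      ≤ volume {w | ENNReal.ofReal ((l / 2) ^ 2) ≤ ‖T f1 w‖ₑ ^ 2} := measure_mono hsub
    _ = ENNReal.ofReal (4 / l ^ 2) * (ENNReal.ofReal ((l / 2) ^ 2) *
        volume {w | ENNReal.ofReal ((l / 2) ^ 2) ≤ ‖T f1 w‖ₑ ^ 2}) := by
        rw [← mul_assoc, hcoef, one_mul]
    _ ≤ ENNReal.ofReal (4 / l ^ 2) * ∫⁻ w, ‖T f1 w‖ₑ ^ 2 := by gcongr
    _ ≤ ENNReal.ofReal (4 / l ^ 2) * ∫⁻ z, ‖f1 z‖ₑ ^ 2 :=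
        mul_le_mul_right (hT.two f1 hi1) _
    _ = _ := by
        congr 2; ext z
        simp only [hf1]
        by_cases hz : z ∈ S <;> simp [hz]

lemma marc_pos {T : (ℝ × ℝ → ℂ) → (ℝ × ℝ → ℂ)} {A : ℝ} (hT : DispOp T A) {q : ℝ} (hq : 2 < q)
    {f : ℝ × ℝ → ℂ} (hf : Integrable f) (hfm : Measurable f) {N : ℝ} (hN : 0 < N)
    (hfN : ∫⁻ z, ‖f z‖ₑ ^ (q / (q - 1)) ≤ ENNReal.ofReal N) :
    ∫⁻ w, ‖T f w‖ₑ ^ q ≤ ENNReal.ofReal (4 * q / (q - 2) * (2 * A * N) ^ (q - 2) * N) := by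
  have hA := hT.pos
  set r : ℝ := 1 / (q - 1) with hr
  have hq1 : 0 < q - 1 := by linarith
  have hq2 : 0 < q - 2 := by linarith
  have hr0 : 0 < r := by positivity
  have hr1 : q / (q - 1) = r + 1 := by rw [hr]; field_simp; ring
  rw [hr1] at hfN
  set D : ℝ := 2 * A * N with hD
  have hD0 : 0 < D := by positivity
  have hlc := lintegral_rpow_eq_lintegral_meas_lt_mul (volume : Measure (ℝ × ℝ))
    (f := fun w => ‖T f w‖) (Filter.Eventually.of_forall fun w => norm_nonneg _)
    (hT.meas f hf).norm.aemeasurable (p := q) (by linarith)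
  simp_rw [enorm_rpow_eq _ (by linarith : (0:ℝ) ≤ q)]
  rw [hlc]
  set k : ℝ → ℝ × ℝ → ℝ≥0∞ := fun l z =>
    ENNReal.ofReal (4 * l ^ (q - 3)) * {z | l * ‖f z‖ ^ r ≤ D}.indicator (fun z => ‖f z‖ₑ ^ 2) z
    with hk
  have hkm : Measurable (fun x : ℝ × (ℝ × ℝ) => k x.1 x.2) := by
    simp only [hk]
    apply Measurable.mul
    · exact ((measurable_fst.pow_const (q - 3)).const_mul 4).ennreal_ofReal
    · have : (fun x : ℝ × (ℝ × ℝ) => {z | x.1 * ‖f z‖ ^ r ≤ D}.indicator (fun z => ‖f z‖ₑ ^ 2) x.2)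
          = {x : ℝ × (ℝ × ℝ) | x.1 * ‖f x.2‖ ^ r ≤ D}.indicator (fun x => ‖f x.2‖ₑ ^ 2) := by
        ext x; simp only [indicator, mem_ofPred_eq]
      rw [this]
      apply Measurable.indicator
      · exact ((hfm.comp measurable_snd).enorm.pow_const 2)
      · apply measurableSet_le _ measurable_const
        exact measurable_fst.mul ((hfm.comp measurable_snd).norm.pow_const r)
  have hstep : ∫⁻ l in Ioi (0:ℝ), volume {w | l < ‖T f w‖} * ENNReal.ofReal (l ^ (q - 1)) ≤
      ∫⁻ l in Ioi (0:ℝ), ∫⁻ z, k l z := by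
    apply setLIntegral_mono' measurableSet_Ioi
    intro l hl
    have hl : 0 < l := hl
    calc _ ≤ (ENNReal.ofReal (4 / l ^ 2) *
          ∫⁻ z, {z | l * ‖f z‖ ^ r ≤ D}.indicator (fun z => ‖f z‖ₑ ^ 2) z) *
            ENNReal.ofReal (l ^ (q - 1)) := by
          gcongr; exact marc_level hT hr0 hf hfm hN hfN hl
      _ = ENNReal.ofReal (4 * l ^ (q - 3)) *
          ∫⁻ z, {z | l * ‖f z‖ ^ r ≤ D}.indicator (fun z => ‖f z‖ₑ ^ 2) z := by
          rw [mul_right_comm, ← ENNReal.ofReal_mul (by positivity)]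
          congr 2
          rw [show q - 1 = (q - 3) + 2 by ring, Real.rpow_add hl]
          norm_cast
          field_simp
      _ = _ := by rw [← lintegral_const_mul' _ _ ENNReal.ofReal_ne_top]
  have hinner : ∀ z, ∫⁻ l in Ioi (0:ℝ), k l z ≤
      ENNReal.ofReal (4 / (q - 2) * D ^ (q - 2)) * ‖f z‖ₑ ^ (r + 1) := by
    intro z
    by_cases hz : f z = 0
    · have : ∀ l, k l z = 0 := by intro l; simp [hk, hz, indicator]
      simp [this]
    have hz0 : 0 < ‖f z‖ := norm_pos_iff.mpr hz
    have hzr : 0 < ‖f z‖ ^ r := Real.rpow_pos_of_pos hz0 r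
    set L := D / ‖f z‖ ^ r with hL
    have hL0 : 0 < L := by positivity
    calc ∫⁻ l in Ioi (0:ℝ), k l z
        ≤ ∫⁻ l in Ioi (0:ℝ), (Iic L).indicator (fun l => ENNReal.ofReal (4 * l ^ (q - 3)) * ‖f z‖ₑ ^ 2) l := by
          apply lintegral_mono; intro l
          simp only [hk, indicator, mem_ofPred_eq, mem_Iic, hL, le_div_iff₀ hzr]
          split_ifs <;> simp
      _ = ∫⁻ l in Ioc 0 L, ENNReal.ofReal (4 * l ^ (q - 3)) * ‖f z‖ₑ ^ 2 := by
          rw [setLIntegral_indicator measurableSet_Iic, inter_comm, Ioi_inter_Iic]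
      _ = (∫⁻ l in Ioc 0 L, ENNReal.ofReal (4 * l ^ (q - 3))) * ‖f z‖ₑ ^ 2 := by
          rw [lintegral_mul_const' _ _ (by simp)]
      _ = ENNReal.ofReal (4 * (L ^ (q - 2) / (q - 2))) * ‖f z‖ₑ ^ 2 := by
          congr 1
          have hii := (intervalIntegral.intervalIntegrable_rpow' (a := 0) (b := L) (r := q - 3)
            (by linarith)).const_mul 4
          rw [intervalIntegrable_iff_integrableOn_Ioc_of_le hL0.le] at hii
          rw [← ofReal_integral_eq_lintegral_ofReal hii]
          · congr 1
            rw [← intervalIntegral.integral_of_le hL0.le, intervalIntegral.integral_const_mul,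
              integral_rpow (Or.inl (by linarith))]
            rw [show q - 3 + 1 = q - 2 by ring, Real.zero_rpow hq2.ne', sub_zero]
          · filter_upwards [ae_restrict_mem measurableSet_Ioc] with l hl
            have := hl.1
            simp only [Pi.zero_apply]; positivity
      _ = _ := by
          rw [enorm_sq_eq, enorm_rpow_eq _ (by linarith), ← ENNReal.ofReal_mul (by positivity),
            ← ENNReal.ofReal_mul (by positivity)]
          congr 1
          have e1 : L ^ (q - 2) = D ^ (q - 2) / ‖f z‖ ^ (r * (q - 2)) := by
            rw [hL, Real.div_rpow hD0.le hzr.le, ← Real.rpow_mul hz0.le]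
          have e2 : ‖f z‖ ^ (r + 1) = ‖f z‖ ^ 2 / ‖f z‖ ^ (r * (q - 2)) := by
            rw [← Real.rpow_natCast, ← Real.rpow_sub hz0]
            congr 1
            rw [hr]; push_cast; field_simp; ring
          rw [e1, e2]; ring
      _ ≤ _ := le_rfl
  calc _ ≤ ENNReal.ofReal q * ∫⁻ l in Ioi (0:ℝ), ∫⁻ z, k l z := by gcongr
    _ = ENNReal.ofReal q * ∫⁻ z, ∫⁻ l in Ioi (0:ℝ), k l z := by
        rw [lintegral_lintegral_swap hkm.aemeasurable]
    _ ≤ ENNReal.ofReal q * ∫⁻ z, ENNReal.ofReal (4 / (q - 2) * D ^ (q - 2)) * ‖f z‖ₑ ^ (r + 1) := by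
        gcongr with z; exact hinner z
    _ = ENNReal.ofReal q * (ENNReal.ofReal (4 / (q - 2) * D ^ (q - 2)) * ∫⁻ z, ‖f z‖ₑ ^ (r + 1)) := by
        rw [lintegral_const_mul' _ _ ENNReal.ofReal_ne_top]
    _ ≤ ENNReal.ofReal q * (ENNReal.ofReal (4 / (q - 2) * D ^ (q - 2)) * ENNReal.ofReal N) := by
        gcongr
    _ = _ := by
        rw [← ENNReal.ofReal_mul (by positivity), ← ENNReal.ofReal_mul (by linarith)]
        congr 1; ring

lemma marc {T : (ℝ × ℝ → ℂ) → (ℝ × ℝ → ℂ)} {A : ℝ} (hT : DispOp T A) {q : ℝ} (hq : 2 < q)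
    {f : ℝ × ℝ → ℂ} (hf : Integrable f) (hfm : Measurable f) :
    ∫⁻ w, ‖T f w‖ₑ ^ q ≤ ENNReal.ofReal (4 * q / (q - 2) * (2 * A) ^ (q - 2)) *
      (∫⁻ z, ‖f z‖ₑ ^ (q / (q - 1))) ^ (q - 1) := by
  have hA := hT.pos
  have hq1 : 0 < q - 1 := by linarith
  have hq2 : 0 < q - 2 := by linarith
  have hqq : 0 < q / (q - 1) := div_pos (by linarith) hq1
  set I := ∫⁻ z, ‖f z‖ₑ ^ (q / (q - 1)) with hI
  rcases eq_or_ne I ⊤ with ht | ht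
  · rw [ht, ENNReal.top_rpow_of_pos hq1, ENNReal.mul_top]
    · exact le_top
    · have : 0 < 4 * q / (q - 2) * (2 * A) ^ (q - 2) := by positivity
      simpa using this
  rcases eq_or_ne I 0 with h0 | h0
  · have hz : ∫⁻ z, ‖f z‖ₑ = 0 := by
      rw [hI, lintegral_eq_zero_iff (hfm.enorm.pow_const _)] at h0
      rw [lintegral_eq_zero_iff hfm.enorm]
      filter_upwards [h0] with z hz
      simpa [hqq, hqq.le, not_lt.mpr hqq.le] using hz
    have : ∀ w, ‖T f w‖ₑ ^ q = 0 := by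
      intro w
      have := hT.one f hf w
      rw [hz, mul_zero] at this
      have h : ‖T f w‖ₑ = 0 := le_antisymm this zero_le
      rw [h, ENNReal.zero_rpow_of_pos (by linarith)]
    simp [this]
  · have hN : 0 < I.toReal := ENNReal.toReal_pos h0 ht
    have h := marc_pos hT hq hf hfm hN (by rw [ENNReal.ofReal_toReal ht])
    refine h.trans (le_of_eq ?_)
    nth_rewrite 3 [← ENNReal.ofReal_toReal ht]
    rw [ENNReal.ofReal_rpow_of_pos hN, ← ENNReal.ofReal_mul (by positivity)]
    congr 1
    rw [Real.mul_rpow (by positivity) hN.le, show q - 1 = (q - 2) + 1 by ring,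
      Real.rpow_add_one hN.ne']
    ring

def bx (N : ℝ) : Set (ℝ × ℝ) := Ioc (-N) N ×ˢ Ioc (-N) N

/-- propagator symbol -/
def om (t : ℝ) (p : ℝ × ℝ) : ℂ := Complex.exp (((t * (p.1 ^ 3 + p.2 ^ 3) : ℝ) : ℂ) * Complex.I)

lemma norm_om (t : ℝ) (p : ℝ × ℝ) : ‖om t p‖ = 1 := Complex.norm_exp_ofReal_mul_I _

lemma continuous_om : Continuous (fun x : ℝ × (ℝ × ℝ) => om x.1 x.2) := by
  unfold om; fun_prop

lemma measurableSet_bx (N : ℝ) : MeasurableSet (bx N) := measurableSet_Ioc.prod measurableSet_Ioc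

lemma volume_bx_lt_top (N : ℝ) : volume (bx N) < ⊤ := by
  rw [bx, Measure.volume_eq_prod, Measure.prod_prod]
  simp [ENNReal.mul_lt_top]

def mk (N t : ℝ) : ℝ × ℝ → ℂ := (bx N).indicator (om t)

lemma norm_mk_le (N t : ℝ) (p : ℝ × ℝ) : ‖mk N t p‖ ≤ 1 := by
  unfold mk
  refine (norm_indicator_le_norm_self _ _).trans (norm_om t p).le

lemma continuous_om_right (t : ℝ) : Continuous (om t) := by unfold om; fun_prop

lemma integrable_mk (N t : ℝ) : Integrable (mk N t) := by
  unfold mk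
  rw [integrable_indicator_iff (measurableSet_bx N)]
  refine Integrable.mono' (g := fun _ => (1:ℝ))
    (integrableOn_const (volume_bx_lt_top N).ne) (continuous_om_right t).aestronglyMeasurable ?_
  filter_upwards with p; exact (norm_om t p).le

lemma IFT2_mk {N t : ℝ} (hN : 0 ≤ N) (z : ℝ × ℝ) :
    IFT2 (mk N t) z = (∫ x in (-N)..N, cph t (2 * Real.pi * z.1) x) *
      ∫ x in (-N)..N, cph t (2 * Real.pi * z.2) x := by
  have h : -N ≤ N := by linarith
  rw [intervalIntegral.integral_of_le h, intervalIntegral.integral_of_le h]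
  have h3 := setIntegral_prod_mul (μ := (volume : Measure ℝ)) (ν := (volume : Measure ℝ))
    (cph t (2 * Real.pi * z.1)) (cph t (2 * Real.pi * z.2)) (Ioc (-N) N) (Ioc (-N) N)
  rw [← h3, ← Measure.volume_eq_prod, ← integral_indicator (measurableSet_Ioc.prod measurableSet_Ioc), IFT2_eq]
  change _ = ∫ x, (bx N).indicator _ x
  congr 1; ext p
  unfold mk
  by_cases hp : p ∈ bx N
  · rw [indicator_of_mem hp, indicator_of_mem hp]
    simp only [ee, om, cph]
    rw [← Complex.exp_add, ← Complex.exp_add]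
    congr 1; push_cast; ring
  · rw [indicator_of_notMem hp, indicator_of_notMem hp, mul_zero]

lemma norm_IFT2_mk_le {N t : ℝ} (hN : 0 ≤ N) (ht : t ≠ 0) (z : ℝ × ℝ) :
    ‖IFT2 (mk N t) z‖ ≤ 100 * |t| ^ (-(2/3) : ℝ) := by
  rw [IFT2_mk hN, norm_mul]
  have h1 := vdc_full t (2 * Real.pi * z.1) ht hN
  have h2 := vdc_full t (2 * Real.pi * z.2) ht hN
  calc _ ≤ (10 * |t| ^ (-(1/3) : ℝ)) * (10 * |t| ^ (-(1/3) : ℝ)) :=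
        mul_le_mul h1 h2 (norm_nonneg _) (by positivity)
    _ = 100 * (|t| ^ (-(1/3) : ℝ) * |t| ^ (-(1/3) : ℝ)) := by ring
    _ = _ := by rw [← Real.rpow_add (abs_pos.mpr ht)]; norm_num

def Tprop (N t : ℝ) (f : ℝ × ℝ → ℂ) : ℝ × ℝ → ℂ := FT2 (fun p => mk N t p * IFT2 f p)

lemma Tprop_disp {N t : ℝ} (hN : 0 ≤ N) (ht : t ≠ 0) :
    DispOp (Tprop N t) (100 * |t| ^ (-(2/3) : ℝ)) where
  pos := by have := abs_pos.mpr ht; positivity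
  meas := fun f hf => (continuous_FT2 (integrable_mul_IFT2 (integrable_mk N t) hf)).measurable
  add := by
    intro f g hf hg w
    have : (fun p => mk N t p * IFT2 (fun z => f z + g z) p) =
        fun p => mk N t p * IFT2 f p + mk N t p * IFT2 g p := by
      ext p
      rw [← mul_add]; congr 1
      simp only [IFT2_eq, mul_add]
      exact integral_add (integrable_ee_mul hf p) (integrable_ee_mul hg p)
    unfold Tprop
    rw [this]
    simp only [FT2_eq_IFT2, IFT2_eq (_) (-w), mul_add]
    exact integral_add (integrable_ee_mul (integrable_mul_IFT2 (integrable_mk N t) hf) _)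
      (integrable_ee_mul (integrable_mul_IFT2 (integrable_mk N t) hg) _)
  one := by
    intro f hf w
    unfold Tprop
    rw [FT2_mul_IFT2 (integrable_mk N t) hf]
    refine (enorm_integral_le_lintegral_enorm _).trans ?_
    rw [← lintegral_const_mul' _ _ ENNReal.ofReal_ne_top]
    apply lintegral_mono; intro z
    simp only [enorm_mul]
    rw [mul_comm]
    gcongr
    rw [← ofReal_norm]
    exact ENNReal.ofReal_le_ofReal (norm_IFT2_mk_le hN ht _)
  two := by
    intro f hf
    unfold Tprop
    refine (planch_FT2 (integrable_mul_IFT2 (integrable_mk N t) hf)).trans ?_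
    refine le_trans ?_ (planch_IFT2 hf)
    apply lintegral_mono; intro p
    simp only [enorm_mul]
    gcongr
    calc _ ≤ 1 * ‖IFT2 f p‖ₑ := by
          gcongr; rw [← ofReal_norm, ← ENNReal.ofReal_one]
          exact ENNReal.ofReal_le_ofReal (norm_mk_le N t p)
      _ = _ := one_mul _

/-- constant in the bilinear estimate -/
def CB (p q : ℝ) : ℝ := (4 * q / (q - 2)) ^ (1 / q) * 200 ^ (3 / p)

lemma bilin {p q : ℝ} (hp : 3 < p) (hq : 2 < q) (hpq : 3 / p + 2 / q = 1) {N t : ℝ} (hN : 0 ≤ N)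
    (ht : t ≠ 0) {f g : ℝ × ℝ → ℂ} (hf : Integrable f) (hfm : Measurable f)
    (hg : Integrable g) (hgm : Measurable g) :
    ‖∫ ζ in bx N, om t ζ * IFT2 f ζ * starRingEnd ℂ (IFT2 g ζ)‖ₑ ≤
      ENNReal.ofReal (CB p q * |t| ^ (-(2 / p))) *
        ((∫⁻ z, ‖f z‖ₑ ^ (q / (q - 1))) ^ ((q - 1) / q) *
        (∫⁻ z, ‖g z‖ₑ ^ (q / (q - 1))) ^ ((q - 1) / q)) := by
  have hat : 0 < |t| := abs_pos.mpr ht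
  have hM := integrable_mul_IFT2 (integrable_mk N t) hf
  have e : ∫ ζ in bx N, om t ζ * IFT2 f ζ * starRingEnd ℂ (IFT2 g ζ) =
      ∫ w, starRingEnd ℂ (g w) * Tprop N t f w := by
    rw [Tprop, ← parseval_IFT2 hM hg, ← integral_indicator (measurableSet_bx N)]
    congr 1; ext p; unfold mk
    by_cases hp : p ∈ bx N
    · rw [indicator_of_mem hp, indicator_of_mem hp]
    · rw [indicator_of_notMem hp, indicator_of_notMem hp, zero_mul, zero_mul]
  have hconj : (q / (q - 1)).HolderConjugate q := by
    rw [Real.holderConjugate_iff]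
    constructor
    · rw [lt_div_iff₀ (by linarith)]; linarith
    · have : q - 1 ≠ 0 := by linarith
      field_simp; ring
  have hdisp := Tprop_disp hN ht
  have h1 := marc hdisp hq hf hfm
  have hH := ENNReal.lintegral_mul_le_Lp_mul_Lq volume hconj (f := fun w => ‖g w‖ₑ)
    (g := fun w => ‖Tprop N t f w‖ₑ) hgm.enorm.aemeasurable (hdisp.meas f hf).enorm.aemeasurable
  have hexp : (q - 2) / q = 3 / p := by
    have : (q - 2) / q = 1 - 2 / q := by field_simp
    linarith
  rw [e]
  calc _ ≤ ∫⁻ w, ‖starRingEnd ℂ (g w) * Tprop N t f w‖ₑ := enorm_integral_le_lintegral_enorm _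
    _ = ∫⁻ w, ‖g w‖ₑ * ‖Tprop N t f w‖ₑ := by
        congr 1; ext w
        rw [enorm_mul, ← ofReal_norm, RCLike.norm_conj, ofReal_norm]
    _ ≤ (∫⁻ w, ‖g w‖ₑ ^ (q / (q - 1))) ^ (1 / (q / (q - 1))) * (∫⁻ w, ‖Tprop N t f w‖ₑ ^ q) ^ (1 / q) := hH
    _ ≤ (∫⁻ w, ‖g w‖ₑ ^ (q / (q - 1))) ^ ((q - 1) / q) *
        (ENNReal.ofReal (4 * q / (q - 2) * (2 * (100 * |t| ^ (-(2/3) : ℝ))) ^ (q - 2)) *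
      (∫⁻ z, ‖f z‖ₑ ^ (q / (q - 1))) ^ (q - 1)) ^ (1 / q) := by
        rw [one_div_div]
        gcongr
    _ = _ := by
        have hq2 : 0 < q - 2 := by linarith
        rw [ENNReal.mul_rpow_of_nonneg _ _ (by positivity), ← ENNReal.rpow_mul,
          ENNReal.ofReal_rpow_of_pos (by positivity)]
        have : (4 * q / (q - 2) * (2 * (100 * |t| ^ (-(2/3) : ℝ))) ^ (q - 2)) ^ (1 / q) =
            CB p q * |t| ^ (-(2 / p)) := by
          rw [Real.mul_rpow (by positivity) (by positivity), ← Real.rpow_mul (by positivity),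
            mul_one_div, hexp, ← mul_assoc, Real.mul_rpow (by positivity) (by positivity),
            ← Real.rpow_mul hat.le, CB]
          norm_num
          rw [mul_assoc]; congr 3; ring
        rw [this, mul_one_div]; ring

lemma lintegral_abs_le {g : ℝ → ℝ≥0∞} :
    ∫⁻ u, g |u| = 2 * ∫⁻ u in Ioi (0:ℝ), g u := by
  have h1 : ∫⁻ u in Ioi (0:ℝ), g |u| = ∫⁻ u in Ioi (0:ℝ), g u := by
    apply setLIntegral_congr_fun measurableSet_Ioi
    intro u hu; simp only [abs_of_pos (show 0 < u from hu)]
  have h2 : ∫⁻ u in Iio (0:ℝ), g |u| = ∫⁻ u in Ioi (0:ℝ), g |u| := by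
    rw [← lintegral_indicator measurableSet_Iio, ← lintegral_indicator measurableSet_Ioi,
      ← lintegral_neg_eq_self]
    congr 1; ext u
    simp only [indicator, mem_Iio, mem_Ioi, abs_neg, Left.neg_neg_iff]
  rw [← lintegral_add_compl _ (measurableSet_Ioi (a := (0:ℝ))), compl_Ioi,
    setLIntegral_congr (Iio_ae_eq_Iic (a := (0:ℝ))).symm, h2, h1, two_mul]

lemma near_int {α r : ℝ} (hα : α < 1) (hr : 0 < r) :
    ∫⁻ u : ℝ, {u : ℝ | |u| ≤ r}.indicator (fun u => ENNReal.ofReal (|u| ^ (-α))) u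
      = ENNReal.ofReal (2 * (r ^ (1 - α) / (1 - α))) := by
  have := lintegral_abs_le (g := (Iic r).indicator (fun u => ENNReal.ofReal (u ^ (-α))))
  have e : (fun u : ℝ => {u : ℝ | |u| ≤ r}.indicator (fun u => ENNReal.ofReal (|u| ^ (-α))) u) =
     fun u => (Iic r).indicator (fun u => ENNReal.ofReal (u ^ (-α))) |u| := by
    ext u; simp only [indicator, mem_ofPred_eq, mem_Iic]
  rw [e, this, setLIntegral_indicator measurableSet_Iic, inter_comm, Ioi_inter_Iic]
  have hii := (intervalIntegral.intervalIntegrable_rpow' (a := 0) (b := r) (r := -α)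
            (by linarith))
  rw [intervalIntegrable_iff_integrableOn_Ioc_of_le hr.le] at hii
  rw [← ofReal_integral_eq_lintegral_ofReal hii, ← intervalIntegral.integral_of_le hr.le,
      integral_rpow (Or.inl (by linarith)), ENNReal.ofReal_mul (by norm_num)]
  · rw [show -α + 1 = 1 - α by ring, Real.zero_rpow (by linarith), sub_zero]; simp
  · filter_upwards [ae_restrict_mem measurableSet_Ioc] with l hl
    have := hl.1
    simp only [Pi.zero_apply]; positivity

lemma far_int {r : ℝ} (hr : 0 < r) :
    ∫⁻ u : ℝ, {u : ℝ | r < |u|}.indicator (fun u => ENNReal.ofReal (|u| ^ (-2 : ℝ))) u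
      = ENNReal.ofReal (2 / r) := by
  have := lintegral_abs_le (g := (Ioi r).indicator (fun u => ENNReal.ofReal (u ^ (-2 : ℝ))))
  have e : (fun u : ℝ => {u : ℝ | r < |u|}.indicator (fun u => ENNReal.ofReal (|u| ^ (-2 : ℝ))) u) =
     fun u => (Ioi r).indicator (fun u => ENNReal.ofReal (u ^ (-2 : ℝ))) |u| := by
    ext u; simp only [indicator, mem_ofPred_eq, mem_Ioi]
  rw [e, this, setLIntegral_indicator measurableSet_Ioi, Ioi_inter_Ioi, max_eq_left hr.le]
  rw [← ofReal_integral_eq_lintegral_ofReal (integrableOn_Ioi_rpow_of_lt (by norm_num) hr),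
     integral_Ioi_rpow_of_lt (by norm_num) hr]
  · norm_num
    rw [Real.rpow_neg_one, div_eq_mul_inv, ENNReal.ofReal_mul (by norm_num)]
    simp
  · filter_upwards [ae_restrict_mem measurableSet_Ioi] with l hl
    have : 0 < l := hr.trans hl
    simp only [Pi.zero_apply]; positivity

/-- constant of the diagonal Hardy-Littlewood-Sobolev inequality -/
def CH (p : ℝ) : ℝ := 2 / (1 - 2 / p) + 2 ^ (1 / p)

lemma hls_inner {p : ℝ} (hp : 2 < p) {h : ℝ → ℝ≥0∞} (hm : Measurable h) {A N : ℝ} (hA : 0 < A)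
    (hN : 0 < N) (hhN : (∫⁻ s, h s ^ (p / (p - 1))) ^ ((p - 1) / p) ≤ ENNReal.ofReal N) (t : ℝ) :
    ∫⁻ s, min (h s) (ENNReal.ofReal A) * ENNReal.ofReal (|t - s| ^ (-(2 / p))) ≤
      ENNReal.ofReal (CH p * N ^ (2 - p / (p - 1)) * A ^ (p / (p - 1) - 1)) := by
  have hp1 : 0 < p - 1 := by linarith
  have hα : 2 / p < 1 := by rw [div_lt_one (by linarith)]; exact hp
  set r : ℝ := (N / A) ^ (p / (p - 1)) with hr
  have hr0 : 0 < r := by positivity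
  set k : ℝ → ℝ≥0∞ := fun u => ENNReal.ofReal (|u| ^ (-(2 / p))) with hk
  have hkm : Measurable k := by
    simp only [hk]; exact (measurable_id.abs.pow_const _).ennreal_ofReal
  set k1 : ℝ → ℝ≥0∞ := {u : ℝ | |u| ≤ r}.indicator k with hk1
  set k2 : ℝ → ℝ≥0∞ := {u : ℝ | r < |u|}.indicator k with hk2
  have hk2m : Measurable k2 := hkm.indicator (measurableSet_lt measurable_const measurable_id.abs)
  have hk1m : Measurable k1 := hkm.indicator (measurableSet_le measurable_id.abs measurable_const)
  have b1 : ∫⁻ s, ENNReal.ofReal A * k1 (t - s) =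
      ENNReal.ofReal (A * (2 * (r ^ (1 - 2 / p) / (1 - 2 / p)))) := by
    rw [lintegral_const_mul' _ _ ENNReal.ofReal_ne_top, lintegral_sub_left_eq_self k1 t,
      near_int hα hr0, ENNReal.ofReal_mul hA.le]
  have hconj : (p / (p - 1)).HolderConjugate p := by
    rw [Real.holderConjugate_iff]
    constructor
    · rw [lt_div_iff₀ (by linarith)]; linarith
    · have : p - 1 ≠ 0 := by linarith
      field_simp; ring
  have b2 : ∫⁻ s, h s * k2 (t - s) ≤ ENNReal.ofReal (N * (2 / r) ^ (1 / p)) := by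
    have hH := ENNReal.lintegral_mul_le_Lp_mul_Lq volume hconj (f := h)
      (g := fun s => k2 (t - s)) hm.aemeasurable
      (hk2m.comp (measurable_const.sub measurable_id)).aemeasurable
    refine hH.trans ?_
    have e : ∫⁻ s, k2 (t - s) ^ p = ENNReal.ofReal (2 / r) := by
      rw [lintegral_sub_left_eq_self (fun u => k2 u ^ p) t, ← far_int hr0]
      congr 1; ext u
      simp only [hk2, indicator, mem_ofPred_eq]
      split_ifs with hu
      · simp only [hk]
        rw [ENNReal.ofReal_rpow_of_nonneg (by positivity) (by linarith),
          ← Real.rpow_mul (abs_nonneg _)]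
        congr 2; field_simp
      · exact ENNReal.zero_rpow_of_pos (by linarith)
    rw [e, ENNReal.ofReal_rpow_of_pos (by positivity), one_div_div, ENNReal.ofReal_mul hN.le]
    gcongr
  have hsplit : ∀ s, min (h s) (ENNReal.ofReal A) * k (t - s) ≤
      ENNReal.ofReal A * k1 (t - s) + h s * k2 (t - s) := by
    intro s
    simp only [hk1, hk2, indicator, mem_ofPred_eq]
    by_cases hc : |t - s| ≤ r
    · rw [if_pos hc, if_neg (not_lt.mpr hc), mul_zero, add_zero]
      gcongr; exact min_le_right _ _
    · rw [if_neg hc, if_pos (not_le.mp hc), mul_zero, zero_add]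
      gcongr; exact min_le_left _ _
  have e1 : r ^ (1 - 2 / p) = N ^ (2 - p / (p - 1)) / A ^ (2 - p / (p - 1)) := by
    rw [hr, ← Real.rpow_mul (by positivity), Real.div_rpow hN.le hA.le]
    have : p / (p - 1) * (1 - 2 / p) = 2 - p / (p - 1) := by field_simp; ring
    rw [this]
  have e2 : r ^ (1 / p) = N ^ (p / (p - 1) - 1) / A ^ (p / (p - 1) - 1) := by
    rw [hr, ← Real.rpow_mul (by positivity), Real.div_rpow hN.le hA.le]
    have : p / (p - 1) * (1 / p) = p / (p - 1) - 1 := by field_simp; ring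
    rw [this]
  calc _ ≤ ∫⁻ s, (ENNReal.ofReal A * k1 (t - s) + h s * k2 (t - s)) := lintegral_mono hsplit
    _ = (∫⁻ s, ENNReal.ofReal A * k1 (t - s)) + ∫⁻ s, h s * k2 (t - s) := by
        apply lintegral_add_left
        exact (hk1m.comp (measurable_const.sub measurable_id)).const_mul _
    _ ≤ ENNReal.ofReal (A * (2 * (r ^ (1 - 2 / p) / (1 - 2 / p)))) +
          ENNReal.ofReal (N * (2 / r) ^ (1 / p)) := by
        rw [b1]; gcongr
    _ = _ := by
        have hα' : 0 < 1 - 2 / p := by linarith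
        rw [← ENNReal.ofReal_add (by positivity) (by positivity)]
        congr 1
        rw [Real.div_rpow (by norm_num) hr0.le, e1, e2, CH]
        have f1 : A ^ (p / (p - 1) - 1) = A / A ^ (2 - p / (p - 1)) := by
          rw [← Real.rpow_one_sub' hA.le]
          · congr 1; ring
          · intro h0
            have : p / (p - 1) = 1 := by linarith
            rw [div_eq_one_iff_eq hp1.ne'] at this; linarith
        have f2 : N ^ (2 - p / (p - 1)) = N / N ^ (p / (p - 1) - 1) := by
          rw [← Real.rpow_one_sub' hN.le]
          · congr 1; ring
          · intro h0
            have : p / (p - 1) = 2 := by linarith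
            rw [div_eq_iff hp1.ne'] at this; linarith
        rw [f2]
        have hApos : 0 < A ^ (p / (p - 1) - 1) := by positivity
        have hNpos : 0 < N ^ (p / (p - 1) - 1) := by positivity
        have f3 : A / A ^ (2 - p / (p - 1)) = A ^ (p / (p - 1) - 1) := f1.symm
        calc _ = (A / A ^ (2 - p / (p - 1))) * (2 * (N / N ^ (p / (p - 1) - 1) / (1 - 2 / p))) +
              N * (2 ^ (1 / p) / (N ^ (p / (p - 1) - 1) / A ^ (p / (p - 1) - 1))) := by ring
          _ = _ := by rw [f3]; field_simp

lemma hls {p : ℝ} (hp : 2 < p) {h : ℝ → ℝ≥0∞} (hm : Measurable h) (hfin : ∀ t, h t ≠ ⊤) :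
    ∫⁻ t, ∫⁻ s, h t * h s * ENNReal.ofReal (|t - s| ^ (-(2 / p))) ≤
      ENNReal.ofReal (2 * CH p) * (∫⁻ s, h s ^ (p / (p - 1))) ^ (2 * ((p - 1) / p)) := by
  have hp1 : 0 < p - 1 := by linarith
  have hα : 2 / p < 1 := by rw [div_lt_one (by linarith)]; exact hp
  have hα' : 0 < 1 - 2 / p := by linarith
  have hCH : 0 < CH p := by unfold CH; positivity
  have hb : 0 < p / (p - 1) := by positivity
  set I := ∫⁻ s, h s ^ (p / (p - 1)) with hI
  rcases eq_or_ne I ⊤ with hT | hT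
  · rw [hT, ENNReal.top_rpow_of_pos (by positivity), ENNReal.mul_top]
    · exact le_top
    · simpa using hCH
  rcases eq_or_ne I 0 with h0 | h0
  · rw [hI, lintegral_eq_zero_iff (hm.pow_const _)] at h0
    have h0' : ∀ᵐ t, h t = 0 := by
      filter_upwards [h0] with z hz
      simpa [hb, hb.le, not_lt.mpr hb.le] using hz
    have : ∫⁻ t, ∫⁻ s, h t * h s * ENNReal.ofReal (|t - s| ^ (-(2 / p))) = 0 := by
      rw [lintegral_congr_ae (g := fun _ => 0)]
      · simp
      · filter_upwards [h0'] with t ht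
        simp [ht]
    rw [this]; exact zero_le
  set N := (I ^ ((p - 1) / p)).toReal with hN
  have hIp : I ^ ((p - 1) / p) ≠ ⊤ := ENNReal.rpow_ne_top_of_nonneg (by positivity) hT
  have hN0 : 0 < N := ENNReal.toReal_pos (by
    rw [Ne, ENNReal.rpow_eq_zero_iff]
    push Not
    exact ⟨fun h => absurd h h0, fun h => absurd h hT⟩) hIp
  have hNI : I ^ ((p - 1) / p) = ENNReal.ofReal N := (ENNReal.ofReal_toReal hIp).symm
  set K : ℝ → ℝ → ℝ≥0∞ := fun t s => ENNReal.ofReal (|t - s| ^ (-(2 / p))) with hK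
  have hKs : ∀ t s, K t s = K s t := by intro t s; simp only [hK, abs_sub_comm]
  have hKm : Measurable (fun x : ℝ × ℝ => K x.1 x.2) := by
    simp only [hK]
    exact (((measurable_fst.sub measurable_snd).abs).pow_const _).ennreal_ofReal
  set J : ℝ → ℝ → ℝ≥0∞ := fun t s => h t * (min (h s) (h t) * K t s) with hJ
  have hJm : Measurable (fun x : ℝ × ℝ => J x.1 x.2) := by
    simp only [hJ]
    have a := hm.comp (measurable_fst : Measurable (Prod.fst : ℝ × ℝ → ℝ))
    have b := hm.comp (measurable_snd : Measurable (Prod.snd : ℝ × ℝ → ℝ))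
    exact a.mul ((b.min a).mul hKm)
  have hle : ∀ t s, h t * h s * K t s ≤ J t s + J s t := by
    intro t s
    simp only [hJ]
    rcases le_total (h s) (h t) with hc | hc
    · rw [min_eq_left hc, mul_assoc]; exact le_self_add
    · rw [min_comm (h t), min_comm (h s), min_eq_left hc, hKs t s]
      refine le_trans (le_of_eq ?_) le_add_self
      ring
  have hinner : ∀ t, ∫⁻ s, J t s ≤
      ENNReal.ofReal (CH p * N ^ (2 - p / (p - 1))) * h t ^ (p / (p - 1)) := by
    intro t
    simp only [hJ]
    rw [lintegral_const_mul' _ _ (hfin t)]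
    rcases eq_or_ne (h t) 0 with hz | hz
    · rw [hz]; simp
    have hA : 0 < (h t).toReal := ENNReal.toReal_pos hz (hfin t)
    have e : h t = ENNReal.ofReal (h t).toReal := (ENNReal.ofReal_toReal (hfin t)).symm
    have := hls_inner hp hm hA hN0 hNI.le t
    rw [← e] at this
    calc _ ≤ h t * ENNReal.ofReal (CH p * N ^ (2 - p / (p - 1)) * (h t).toReal ^ (p / (p - 1) - 1)) := by
          gcongr
      _ = _ := by
          rw [e, ENNReal.toReal_ofReal hA.le, ENNReal.ofReal_rpow_of_pos hA,
            ← ENNReal.ofReal_mul hA.le, ← ENNReal.ofReal_mul (by positivity)]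
          congr 1
          rw [Real.rpow_sub_one hA.ne']; field_simp
  have hswap : ∫⁻ t, ∫⁻ s, J s t = ∫⁻ t, ∫⁻ s, J t s := by
    exact (lintegral_lintegral_swap (f := J) hJm.aemeasurable).symm
  calc _ ≤ ∫⁻ t, ∫⁻ s, (J t s + J s t) := lintegral_mono fun t => lintegral_mono fun s => hle t s
    _ = ∫⁻ t, ((∫⁻ s, J t s) + ∫⁻ s, J s t) := by
        congr 1; ext t
        exact lintegral_add_left (hJm.comp (measurable_const.prodMk measurable_id)) _
    _ = (∫⁻ t, ∫⁻ s, J t s) + ∫⁻ t, ∫⁻ s, J s t :=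
        lintegral_add_left hJm.lintegral_prod_right' _
    _ = 2 * ∫⁻ t, ∫⁻ s, J t s := by rw [hswap, two_mul]
    _ ≤ 2 * ∫⁻ t, ENNReal.ofReal (CH p * N ^ (2 - p / (p - 1))) * h t ^ (p / (p - 1)) := by
        gcongr with t; exact hinner t
    _ = 2 * (ENNReal.ofReal (CH p * N ^ (2 - p / (p - 1))) * I) := by
        rw [lintegral_const_mul' _ _ ENNReal.ofReal_ne_top]
    _ = _ := by
        have hIr : 0 < I.toReal := ENNReal.toReal_pos h0 hT
        have hNr : N = I.toReal ^ ((p - 1) / p) := by rw [hN, ENNReal.toReal_rpow]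
        rw [← ENNReal.ofReal_toReal hT, ENNReal.ofReal_rpow_of_pos hIr,
          ← ENNReal.ofReal_mul (by positivity), ← ENNReal.ofReal_mul (by positivity)]
        rw [show (2 : ℝ≥0∞) = ENNReal.ofReal 2 by simp, ← ENNReal.ofReal_mul (by norm_num)]
        congr 1
        rw [hNr, ← Real.rpow_mul hIr.le]
        have : I.toReal ^ (2 * ((p - 1) / p)) =
            I.toReal ^ ((p - 1) / p * (2 - p / (p - 1))) * I.toReal := by
          rw [← Real.rpow_add_one hIr.ne']; congr 1; field_simp; ring
        rw [this]; ring

lemma tts_sq {Z : Type*} [MeasurableSpace Z] {μ : Measure Z} [IsFiniteMeasure μ]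
    {D : ℝ → Z → ℂ} (hD : Measurable (fun x : ℝ × Z => D x.1 x.2)) {b : ℝ → ℝ} (hb : Integrable b)
    (hDb : ∀ t ζ, ‖D t ζ‖ ≤ b t) :
    ∫⁻ ζ, ‖∫ t, D t ζ‖ₑ ^ 2 ∂μ ≤
      ∫⁻ t, ∫⁻ s, ‖∫ ζ, D t ζ * starRingEnd ℂ (D s ζ) ∂μ‖ₑ := by
  have hb0 : ∀ t, Nonempty Z → 0 ≤ b t := fun t ⟨z⟩ => (norm_nonneg _).trans (hDb t z)
  have hGm : StronglyMeasurable (fun ζ => ∫ t, D t ζ) := by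
    have : StronglyMeasurable (fun x : Z × ℝ => D x.2 x.1) :=
      (hD.comp measurable_swap).stronglyMeasurable
    exact this.integral_prod_right'
  have hGb : ∀ ζ, ‖∫ t, D t ζ‖ ≤ ∫ t, b t := fun ζ =>
    norm_integral_le_of_norm_le hb (Filter.Eventually.of_forall fun t => hDb t ζ)
  have hbig : Measurable (fun x : Z × (ℝ × ℝ) => D x.2.1 x.1 * starRingEnd ℂ (D x.2.2 x.1)) := by
    have h1 : Measurable (fun x : Z × (ℝ × ℝ) => D x.2.1 x.1) :=
      hD.comp ((measurable_fst.comp measurable_snd).prodMk measurable_fst)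
    have h2 : Measurable (fun x : Z × (ℝ × ℝ) => D x.2.2 x.1) :=
      hD.comp ((measurable_snd.comp measurable_snd).prodMk measurable_fst)
    exact h1.mul (Complex.continuous_conj.measurable.comp h2)
  have hInteg : Integrable (fun x : Z × (ℝ × ℝ) => D x.2.1 x.1 * starRingEnd ℂ (D x.2.2 x.1))
      (μ.prod (volume : Measure (ℝ × ℝ))) := by
    have hbb : Integrable (fun x : Z × (ℝ × ℝ) => (1 : ℝ) * (b x.2.1 * b x.2.2))
        (μ.prod (volume : Measure (ℝ × ℝ))) :=
      (integrable_const (1 : ℝ)).mul_prod (hb.mul_prod hb)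
    refine hbb.mono' hbig.aestronglyMeasurable (Filter.Eventually.of_forall fun x => ?_)
    rw [norm_mul, RCLike.norm_conj, one_mul]
    exact mul_le_mul (hDb _ _) (hDb _ _) (norm_nonneg _) ((norm_nonneg _).trans (hDb x.2.1 x.1))
  have hL : ∫⁻ ζ, ‖∫ t, D t ζ‖ₑ ^ 2 ∂μ =
      ‖∫ ζ, (∫ t, D t ζ) * starRingEnd ℂ (∫ t, D t ζ) ∂μ‖ₑ := by
    have hi : Integrable (fun ζ => ‖∫ t, D t ζ‖ ^ 2) μ := by
      refine Integrable.mono' (integrable_const ((∫ t, b t) ^ 2))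
        (hGm.norm.pow 2).aestronglyMeasurable (Filter.Eventually.of_forall fun ζ => ?_)
      rw [norm_pow, norm_norm]
      exact pow_le_pow_left₀ (norm_nonneg _) (hGb ζ) 2
    have : ∀ ζ, (∫ t, D t ζ) * starRingEnd ℂ (∫ t, D t ζ) = ((‖∫ t, D t ζ‖ ^ 2 : ℝ) : ℂ) := by
      intro ζ; rw [Complex.mul_conj, Complex.normSq_eq_norm_sq]
    simp_rw [this, enorm_sq_eq]
    rw [integral_complex_ofReal, ← ofReal_integral_eq_lintegral_ofReal hi
      (Filter.Eventually.of_forall fun ζ => by positivity), ← ofReal_norm, Complex.norm_real,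
      Real.norm_of_nonneg (integral_nonneg fun ζ => by positivity)]
  have hprod : ∀ ζ, (∫ t, D t ζ) * starRingEnd ℂ (∫ t, D t ζ) =
      ∫ x : ℝ × ℝ, D x.1 ζ * starRingEnd ℂ (D x.2 ζ) := by
    intro ζ
    rw [← integral_conj]
    exact (integral_prod_mul (μ := volume) (ν := volume) (fun t => D t ζ)
      (fun t => starRingEnd ℂ (D t ζ))).symm
  rw [hL]
  simp_rw [hprod]
  rw [integral_integral_swap (f := fun (ζ : Z) (x : ℝ × ℝ) => D x.1 ζ * starRingEnd ℂ (D x.2 ζ)) hInteg]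
  refine (enorm_integral_le_lintegral_enorm _).trans (le_of_eq ?_)
  have hm2 : StronglyMeasurable (fun x : ℝ × ℝ => ∫ ζ, D x.1 ζ * starRingEnd ℂ (D x.2 ζ) ∂μ) := by
    have : StronglyMeasurable (fun y : (ℝ × ℝ) × Z => D y.1.1 y.2 * starRingEnd ℂ (D y.1.2 y.2)) :=
      (hbig.comp measurable_swap).stronglyMeasurable
    exact this.integral_prod_right'
  rw [Measure.volume_eq_prod, lintegral_prod _ hm2.measurable.enorm.aemeasurable]

lemma tts {p q : ℝ} (hp : 3 < p) (hq : 2 < q) (hpq : 3 / p + 2 / q = 1)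
    {F : ℝ → ℝ × ℝ → ℂ} (hF : Measurable (fun x : ℝ × (ℝ × ℝ) => F x.1 x.2)) {R M : ℝ}
    (hM : ∀ t z, ‖F t z‖ ≤ M) (hsupp : ∀ t z, F t z ≠ 0 → t ∈ Ioc (-R) R ∧ z ∈ bx R) :
    ∫⁻ ζ, ‖∫ t, om t ζ * IFT2 (F t) ζ‖ₑ ^ 2 ≤
      ENNReal.ofReal (CB p q * (2 * CH p)) *
        (∫⁻ t, ((∫⁻ z, ‖F t z‖ₑ ^ (q / (q - 1))) ^ ((q - 1) / q)) ^ (p / (p - 1))) ^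
          (2 * ((p - 1) / p)) := by
  have hM0 : 0 ≤ M := (norm_nonneg _).trans (hM 0 0)
  have hFt : ∀ t, Measurable (F t) := fun t => hF.comp (measurable_const.prodMk measurable_id)
  have hFle : ∀ t z, ‖F t z‖ ≤ (bx R).indicator (fun _ => M) z := by
    intro t z
    by_cases h : F t z = 0
    · rw [h, norm_zero]; exact indicator_nonneg (fun _ _ => hM0) z
    · rw [indicator_of_mem (hsupp t z h).2]; exact hM t z
  have hci : Integrable ((bx R).indicator (fun _ => M)) :=
    (integrable_indicator_iff (measurableSet_bx R)).2 (integrableOn_const (volume_bx_lt_top R).ne)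
  have hFi : ∀ t, Integrable (F t) := fun t =>
    hci.mono' (hFt t).aestronglyMeasurable (Filter.Eventually.of_forall (hFle t))
  set M' := ∫ z, (bx R).indicator (fun _ => M) z with hM'
  have hDm : Measurable (fun x : ℝ × (ℝ × ℝ) => om x.1 x.2 * IFT2 (F x.1) x.2) := by
    refine continuous_om.measurable.mul ?_
    simp_rw [IFT2_eq]
    have : StronglyMeasurable (fun y : (ℝ × (ℝ × ℝ)) × (ℝ × ℝ) => ee y.1.2 y.2 * F y.1.1 y.2) := by
      apply Measurable.stronglyMeasurable
      refine (continuous_ee.measurable.comp (by fun_prop :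
        Measurable fun y : (ℝ × (ℝ × ℝ)) × (ℝ × ℝ) => (y.1.2, y.2))).mul
        (hF.comp (by fun_prop : Measurable fun y : (ℝ × (ℝ × ℝ)) × (ℝ × ℝ) => (y.1.1, y.2)))
    exact this.integral_prod_right'.measurable
  have hDb : ∀ t ζ, ‖om t ζ * IFT2 (F t) ζ‖ ≤ (Ioc (-R) R).indicator (fun _ => M') t := by
    intro t ζ
    rw [norm_mul, norm_om, one_mul]
    by_cases h : t ∈ Ioc (-R) R
    · rw [indicator_of_mem h]
      exact (norm_IFT2_le _ _).trans (integral_mono (hFi t).norm hci (hFle t))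
    · rw [indicator_of_notMem h, IFT2_eq]
      have : ∀ z, F t z = 0 := fun z => by by_contra h'; exact h (hsupp t z h').1
      simp [this]
  have hb : Integrable ((Ioc (-R) R).indicator (fun _ => M')) :=
    (integrable_indicator_iff measurableSet_Ioc).2 (integrableOn_const (by simp))
  set h : ℝ → ℝ≥0∞ := fun t => (∫⁻ z, ‖F t z‖ₑ ^ (q / (q - 1))) ^ ((q - 1) / q) with hh
  have hq1 : 0 < q - 1 := by linarith
  have hhm : Measurable h := by
    have : Measurable (fun x : ℝ × (ℝ × ℝ) => ‖F x.1 x.2‖ₑ ^ (q / (q - 1))) :=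
      hF.enorm.pow_const _
    exact this.lintegral_prod_right'.pow_const _
  have hhfin : ∀ t, h t ≠ ⊤ := by
    intro t
    refine ENNReal.rpow_ne_top_of_nonneg (by positivity) ?_
    have : ∫⁻ z, ‖F t z‖ₑ ^ (q / (q - 1)) ≤
        ∫⁻ z, (bx R).indicator (fun _ => ENNReal.ofReal (M ^ (q / (q - 1)))) z := by
      apply lintegral_mono; intro z
      by_cases h0 : F t z = 0
      · simp only [h0, enorm_zero]
        rw [ENNReal.zero_rpow_of_pos (by positivity)]; exact zero_le
      · simp only [indicator_of_mem (hsupp t z h0).2]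
        rw [enorm_rpow_eq _ (by positivity)]
        gcongr
        exact hM t z
    refine (this.trans_lt ?_).ne
    rw [lintegral_indicator (measurableSet_bx R), lintegral_const, Measure.restrict_apply_univ]
    exact ENNReal.mul_lt_top ENNReal.ofReal_lt_top (volume_bx_lt_top R)
  have hCB : 0 ≤ CB p q := by
    unfold CB
    have : 0 < q - 2 := by linarith
    positivity
  set X := ENNReal.ofReal (CB p q * (2 * CH p)) *
        (∫⁻ t, h t ^ (p / (p - 1))) ^ (2 * ((p - 1) / p)) with hX
  have hN : ∀ n : ℕ, ∫⁻ ζ in bx n, ‖∫ t, om t ζ * IFT2 (F t) ζ‖ₑ ^ 2 ≤ X := by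
    intro n
    have : IsFiniteMeasure (volume.restrict (bx (n : ℝ))) :=
      ⟨by rw [Measure.restrict_apply_univ]; exact volume_bx_lt_top _⟩
    refine (tts_sq (μ := volume.restrict (bx (n : ℝ))) hDm hb hDb).trans ?_
    have key : ∀ t s, t ≠ s →
        ‖∫ ζ in bx (n : ℝ), om t ζ * IFT2 (F t) ζ * starRingEnd ℂ (om s ζ * IFT2 (F s) ζ)‖ₑ ≤
        ENNReal.ofReal (CB p q) * (h t * h s * ENNReal.ofReal (|t - s| ^ (-(2 / p)))) := by
      intro t s hts
      have := bilin hp hq hpq (N := n) (by positivity) (sub_ne_zero.2 hts) (hFi t) (hFt t)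
        (hFi s) (hFt s)
      rw [ENNReal.ofReal_mul hCB] at this
      have e : ∀ ζ, om t ζ * IFT2 (F t) ζ * starRingEnd ℂ (om s ζ * IFT2 (F s) ζ) =
          om (t - s) ζ * IFT2 (F t) ζ * starRingEnd ℂ (IFT2 (F s) ζ) := by
        intro ζ
        have : om (t - s) ζ = om t ζ * starRingEnd ℂ (om s ζ) := by
          unfold om
          rw [← Complex.exp_conj, ← Complex.exp_add]
          congr 1
          simp only [map_mul, Complex.conj_ofReal, Complex.conj_I]
          push_cast; ring
        rw [this, map_mul]; ring
      simp_rw [e]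
      refine this.trans (le_of_eq ?_)
      simp only [hh]; ring
    calc _ ≤ ∫⁻ t, ∫⁻ s, ENNReal.ofReal (CB p q) *
            (h t * h s * ENNReal.ofReal (|t - s| ^ (-(2 / p)))) := by
          apply lintegral_mono; intro t
          apply lintegral_mono_ae
          filter_upwards [(measure_eq_zero_iff_ae_notMem.1 (measure_singleton t) :
            ∀ᵐ s : ℝ, s ∉ ({t} : Set ℝ))] with s hs
          exact key t s (fun e => hs e.symm)
      _ = ENNReal.ofReal (CB p q) * ∫⁻ t, ∫⁻ s, h t * h s * ENNReal.ofReal (|t - s| ^ (-(2 / p))) := by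
          simp_rw [lintegral_const_mul' _ _ ENNReal.ofReal_ne_top]
      _ ≤ ENNReal.ofReal (CB p q) * (ENNReal.ofReal (2 * CH p) *
          (∫⁻ s, h s ^ (p / (p - 1))) ^ (2 * ((p - 1) / p))) := by
          gcongr
          exact hls (by linarith) hhm hhfin
      _ = X := by rw [hX, ENNReal.ofReal_mul hCB, mul_assoc]
  have hmono : Monotone (fun n : ℕ => bx (n : ℝ)) := by
    intro a b hab
    have : (a : ℝ) ≤ b := by exact_mod_cast hab
    exact prod_mono (Ioc_subset_Ioc (by linarith) this) (Ioc_subset_Ioc (by linarith) this)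
  have hun : ⋃ n : ℕ, bx (n : ℝ) = univ := by
    ext ⟨x, y⟩
    simp only [mem_iUnion, mem_univ, iff_true]
    obtain ⟨n, hn⟩ := exists_nat_gt (max |x| |y|)
    have h1 := abs_lt.1 ((le_max_left _ _).trans_lt hn)
    have h2 := abs_lt.1 ((le_max_right _ _).trans_lt hn)
    exact ⟨n, ⟨h1.1, h1.2.le⟩, ⟨h2.1, h2.2.le⟩⟩
  rw [← setLIntegral_univ, ← hun, setLIntegral_iUnion_of_directed _ hmono.directed_le]
  exact iSup_le hN

lemma uu_meas {g : ℝ × ℝ → ℂ} (hgm : Measurable g) :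
    Measurable (fun x : ℝ × (ℝ × ℝ) => IFT2 (fun ζ => om x.1 ζ * g ζ) x.2) := by
  simp_rw [IFT2_eq]
  have : StronglyMeasurable (fun y : (ℝ × (ℝ × ℝ)) × (ℝ × ℝ) =>
      ee y.1.2 y.2 * (om y.1.1 y.2 * g y.2)) := by
    apply Measurable.stronglyMeasurable
    refine (continuous_ee.measurable.comp (by fun_prop :
      Measurable fun y : (ℝ × (ℝ × ℝ)) × (ℝ × ℝ) => (y.1.2, y.2))).mul
      ((continuous_om.measurable.comp (by fun_prop :
        Measurable fun y : (ℝ × (ℝ × ℝ)) × (ℝ × ℝ) => (y.1.1, y.2))).mul (hgm.comp measurable_snd))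
  exact this.integral_prod_right'.measurable

lemma uu_bd {g : ℝ × ℝ → ℂ} (t : ℝ) (z : ℝ × ℝ) :
    ‖IFT2 (fun ζ => om t ζ * g ζ) z‖ ≤ ∫ ζ, ‖g ζ‖ := by
  refine (norm_IFT2_le _ _).trans (le_of_eq ?_)
  simp [norm_om]

lemma pairing {p q : ℝ} (hp : 3 < p) (hq : 2 < q) (hpq : 3 / p + 2 / q = 1)
    {g : ℝ × ℝ → ℂ} (hg : Integrable g) (hgm : Measurable g)
    {F : ℝ → ℝ × ℝ → ℂ} (hF : Measurable (fun x : ℝ × (ℝ × ℝ) => F x.1 x.2)) {R M : ℝ}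
    (hM : ∀ t z, ‖F t z‖ ≤ M) (hsupp : ∀ t z, F t z ≠ 0 → t ∈ Ioc (-R) R ∧ z ∈ bx R) :
    ‖∫ x : ℝ × (ℝ × ℝ), IFT2 (fun ζ => om x.1 ζ * g ζ) x.2 * F x.1 x.2‖ₑ ≤
      (∫⁻ ζ, ‖g ζ‖ₑ ^ 2) ^ (1 / 2 : ℝ) * (ENNReal.ofReal (CB p q * (2 * CH p)) *
        (∫⁻ t, ((∫⁻ z, ‖F t z‖ₑ ^ (q / (q - 1))) ^ ((q - 1) / q)) ^ (p / (p - 1))) ^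
          (2 * ((p - 1) / p))) ^ (1 / 2 : ℝ) := by
  have hM0 : 0 ≤ M := (norm_nonneg _).trans (hM 0 0)
  have hFint : Integrable (fun x : ℝ × (ℝ × ℝ) => F x.1 x.2) := by
    have hms : MeasurableSet (Ioc (-R) R ×ˢ bx R) := measurableSet_Ioc.prod (measurableSet_bx R)
    have hfin : volume (Ioc (-R) R ×ˢ bx R) ≠ ⊤ := by
      rw [Measure.volume_eq_prod, Measure.prod_prod]
      exact (ENNReal.mul_lt_top (by simp) (volume_bx_lt_top R)).ne
    have hci : Integrable ((Ioc (-R) R ×ˢ bx R).indicator (fun _ => M)) :=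
      (integrable_indicator_iff hms).2 (integrableOn_const hfin)
    refine hci.mono' hF.aestronglyMeasurable (Filter.Eventually.of_forall fun x => ?_)
    by_cases h : F x.1 x.2 = 0
    · rw [h, norm_zero]; exact indicator_nonneg (fun _ _ => hM0) x
    · rw [indicator_of_mem (show x ∈ Ioc (-R) R ×ˢ bx R from hsupp _ _ h)]; exact hM _ _
  have hk : Continuous (fun y : (ℝ × (ℝ × ℝ)) × (ℝ × ℝ) => ee y.1.2 y.2 * om y.1.1 y.2) :=
    (continuous_ee.comp (by fun_prop :
      Continuous fun y : (ℝ × (ℝ × ℝ)) × (ℝ × ℝ) => (y.1.2, y.2))).mul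
      (continuous_om.comp (by fun_prop :
        Continuous fun y : (ℝ × (ℝ × ℝ)) × (ℝ × ℝ) => (y.1.1, y.2)))
  have hInteg : Integrable (fun y : (ℝ × (ℝ × ℝ)) × (ℝ × ℝ) =>
      (ee y.1.2 y.2 * om y.1.1 y.2) * (F y.1.1 y.1.2 * g y.2)) :=
    (hFint.mul_prod hg).bdd_mul (c := 1) hk.aestronglyMeasurable
      (Filter.Eventually.of_forall fun y => by rw [norm_mul, norm_ee, norm_om, one_mul])
  have e : ∫ x : ℝ × (ℝ × ℝ), IFT2 (fun ζ => om x.1 ζ * g ζ) x.2 * F x.1 x.2 =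
      ∫ ζ, g ζ * ∫ t, om t ζ * IFT2 (F t) ζ := by
    calc _ = ∫ x : ℝ × (ℝ × ℝ), ∫ ζ, (ee x.2 ζ * om x.1 ζ) * (F x.1 x.2 * g ζ) := by
          congr 1; ext x
          rw [IFT2_eq, ← integral_mul_const]
          congr 1; ext ζ; ring
      _ = ∫ ζ, ∫ x : ℝ × (ℝ × ℝ), (ee x.2 ζ * om x.1 ζ) * (F x.1 x.2 * g ζ) :=
          integral_integral_swap
            (f := fun (x : ℝ × (ℝ × ℝ)) (ζ : ℝ × ℝ) => (ee x.2 ζ * om x.1 ζ) * (F x.1 x.2 * g ζ)) hInteg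
      _ = _ := by
          congr 1; ext ζ
          have hi : Integrable (fun x : ℝ × (ℝ × ℝ) => (ee x.2 ζ * om x.1 ζ) * F x.1 x.2) :=
            hFint.bdd_mul (c := 1) (hk.comp (by fun_prop :
              Continuous fun x : ℝ × (ℝ × ℝ) => (x, ζ))).aestronglyMeasurable
              (Filter.Eventually.of_forall fun y => by rw [norm_mul, norm_ee, norm_om, one_mul])
          calc _ = ∫ x : ℝ × (ℝ × ℝ), g ζ * ((ee x.2 ζ * om x.1 ζ) * F x.1 x.2) := by
                congr 1; ext x; ring
            _ = g ζ * ∫ x : ℝ × (ℝ × ℝ), (ee x.2 ζ * om x.1 ζ) * F x.1 x.2 := integral_const_mul _ _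
            _ = g ζ * ∫ t, ∫ z, (ee z ζ * om t ζ) * F t z := by
                congr 1
                exact integral_prod _ hi
            _ = _ := by
                congr 2; ext t
                rw [IFT2_eq, ← integral_const_mul]
                congr 1; ext z; rw [ee_comm z ζ]; ring
  rw [e]
  refine (enorm_integral_le_lintegral_enorm _).trans ?_
  simp_rw [enorm_mul]
  have hGm : Measurable (fun ζ => ∫ t, om t ζ * IFT2 (F t) ζ) := by
    have hDm : Measurable (fun x : (ℝ × ℝ) × ℝ => om x.2 x.1 * IFT2 (F x.2) x.1) := by
      refine (continuous_om.measurable.comp measurable_swap).mul ?_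
      simp_rw [IFT2_eq]
      have : StronglyMeasurable (fun y : ((ℝ × ℝ) × ℝ) × (ℝ × ℝ) => ee y.1.1 y.2 * F y.1.2 y.2) := by
        apply Measurable.stronglyMeasurable
        refine (continuous_ee.measurable.comp (by fun_prop :
          Measurable fun y : ((ℝ × ℝ) × ℝ) × (ℝ × ℝ) => (y.1.1, y.2))).mul
          (hF.comp (by fun_prop : Measurable fun y : ((ℝ × ℝ) × ℝ) × (ℝ × ℝ) => (y.1.2, y.2)))
      exact this.integral_prod_right'.measurable
    exact hDm.stronglyMeasurable.integral_prod_right'.measurable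
  refine (ENNReal.lintegral_mul_le_Lp_mul_Lq volume (Real.HolderConjugate.two_two)
    hgm.enorm.aemeasurable hGm.enorm.aemeasurable).trans ?_
  simp only [ENNReal.rpow_two]
  gcongr
  exact tts hp hq hpq hF hM hsupp

lemma enorm_integral_nonneg {X : Type*} [MeasurableSpace X] {μ : Measure X} {f : X → ℂ}
    (hf : Integrable f μ) (h : ∀ x, f x = (‖f x‖ : ℂ)) : ‖∫ x, f x ∂μ‖ₑ = ∫⁻ x, ‖f x‖ₑ ∂μ := by
  have : ∫ x, f x ∂μ = ((∫ x, ‖f x‖ ∂μ : ℝ) : ℂ) := by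
    rw [← integral_complex_ofReal]; congr 1; ext x; exact h x
  rw [this, ← ofReal_norm, Complex.norm_real, Real.norm_of_nonneg (integral_nonneg fun x => norm_nonneg _),
    ofReal_integral_eq_lintegral_ofReal hf.norm (Filter.Eventually.of_forall fun x => norm_nonneg _)]
  simp_rw [ofReal_norm]

/-- truncated space norm -/
def Wt (q : ℝ) (u : ℝ → ℝ × ℝ → ℂ) (N : ℝ) (t : ℝ) : ℝ≥0∞ := ∫⁻ z in bx N, ‖u t z‖ₑ ^ q

/-- truncated time set -/
def St (q : ℝ) (u : ℝ → ℝ × ℝ → ℂ) (N l : ℝ) : Set ℝ :=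
  Ioc (-N) N ∩ {t | ENNReal.ofReal l < Wt q u N t}

lemma Wt_meas {q : ℝ} {u : ℝ → ℝ × ℝ → ℂ} (hu : Measurable (fun x : ℝ × (ℝ × ℝ) => u x.1 x.2))
    (N : ℝ) : Measurable (Wt q u N) := by
  have : Measurable (fun x : ℝ × (ℝ × ℝ) => ‖u x.1 x.2‖ₑ ^ q) := hu.enorm.pow_const _
  exact this.lintegral_prod_right' (ν := volume.restrict (bx N))

lemma St_meas {q : ℝ} {u : ℝ → ℝ × ℝ → ℂ} (hu : Measurable (fun x : ℝ × (ℝ × ℝ) => u x.1 x.2))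
    (N l : ℝ) : MeasurableSet (St q u N l) :=
  measurableSet_Ioc.inter (measurableSet_lt measurable_const (Wt_meas hu N))

lemma Wt_le {q : ℝ} (hq : 0 < q) {u : ℝ → ℝ × ℝ → ℂ} {B : ℝ} (hB : ∀ t z, ‖u t z‖ ≤ B) (N t : ℝ) :
    Wt q u N t ≤ ENNReal.ofReal (B ^ q) * volume (bx N) := by
  unfold Wt
  calc _ ≤ ∫⁻ z in bx N, ENNReal.ofReal (B ^ q) := by
        apply lintegral_mono; intro z
        simp only
        rw [enorm_rpow_eq _ hq.le]
        gcongr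
        exact hB t z
    _ = _ := by rw [lintegral_const, Measure.restrict_apply_univ]

/-- dual test function -/
def Ft (p q : ℝ) (u : ℝ → ℝ × ℝ → ℂ) (N l : ℝ) (t : ℝ) (z : ℝ × ℝ) : ℂ :=
  (St q u N l ×ˢ bx N).indicator (fun x : ℝ × (ℝ × ℝ) => starRingEnd ℂ (u x.1 x.2) *
    ((‖u x.1 x.2‖ ^ (q - 2) * (Wt q u N x.1).toReal ^ (p / q - 1) : ℝ) : ℂ)) (t, z)

lemma rpow_split {a : ℝ} (ha : 0 ≤ a) {q : ℝ} (hq : 1 < q) : a * a ^ (q - 2) = a ^ (q - 1) := by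
  rcases ha.eq_or_lt with rfl | h
  · rw [zero_mul, Real.zero_rpow (by linarith)]
  · rw [mul_comm, ← Real.rpow_add_one h.ne']; congr 1; ring

lemma rpow_between {l L x a : ℝ} (hl : 0 < l) (h1 : l ≤ x) (h2 : x ≤ L) : x ^ a ≤ l ^ a + L ^ a := by
  have hx : 0 < x := hl.trans_le h1
  have hL : 0 < L := hx.trans_le h2
  rcases le_total 0 a with h | h
  · have := Real.rpow_le_rpow hx.le h2 h
    have := Real.rpow_nonneg hl.le a
    linarith
  · have := Real.rpow_le_rpow_of_nonpos hl h1 h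
    have := Real.rpow_nonneg hL.le a
    linarith

lemma norm_Ft {p q : ℝ} (hq : 1 < q) {u : ℝ → ℝ × ℝ → ℂ} {N l t : ℝ} {z : ℝ × ℝ}
    (ht : t ∈ St q u N l) (hz : z ∈ bx N) :
    ‖Ft p q u N l t z‖ = ‖u t z‖ ^ (q - 1) * (Wt q u N t).toReal ^ (p / q - 1) := by
  unfold Ft
  rw [indicator_of_mem (show (t, z) ∈ St q u N l ×ˢ bx N from ⟨ht, hz⟩), norm_mul, RCLike.norm_conj,
    Complex.norm_real, Real.norm_of_nonneg (by positivity), ← mul_assoc,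
    rpow_split (norm_nonneg _) hq]

lemma trunc_bound {p q : ℝ} (hp : 3 < p) (hq : 2 < q) (hpq : 3 / p + 2 / q = 1)
    {g : ℝ × ℝ → ℂ} (hg : Integrable g) (hgm : Measurable g) {N l : ℝ} (hl : 0 < l)
    {u : ℝ → ℝ × ℝ → ℂ} (hu : u = fun t => IFT2 (fun ζ => om t ζ * g ζ)) :
    ∫⁻ t in St q u N l, Wt q u N t ^ (p / q) ≤
      ((∫⁻ ζ, ‖g ζ‖ₑ ^ 2) ^ (1 / 2 : ℝ) *
        ENNReal.ofReal (CB p q * (2 * CH p)) ^ (1 / 2 : ℝ)) ^ p := by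
  have hum : Measurable (fun x : ℝ × (ℝ × ℝ) => u x.1 x.2) := by rw [hu]; exact uu_meas hgm
  set B := ∫ ζ, ‖g ζ‖ with hBdef
  have hB : ∀ t z, ‖u t z‖ ≤ B := by intro t z; rw [hu]; exact uu_bd t z
  have hB0 : 0 ≤ B := integral_nonneg fun _ => norm_nonneg _
  have hWle := Wt_le (q := q) (by linarith) hB N
  have hLfin : ENNReal.ofReal (B ^ q) * volume (bx N) ≠ ⊤ :=
    (ENNReal.mul_lt_top ENNReal.ofReal_lt_top (volume_bx_lt_top N)).ne
  set L := (ENNReal.ofReal (B ^ q) * volume (bx N)).toReal with hL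
  have hWfin : ∀ t, Wt q u N t ≠ ⊤ := fun t => ((hWle t).trans_lt hLfin.lt_top).ne
  have hWL : ∀ t, (Wt q u N t).toReal ≤ L := fun t => ENNReal.toReal_mono hLfin (hWle t)
  have hlW : ∀ t ∈ St q u N l, l ≤ (Wt q u N t).toReal := by
    intro t ht
    exact (ENNReal.ofReal_le_iff_le_toReal (hWfin t)).1 ht.2.le
  have hpos : ∀ t ∈ St q u N l, 0 < (Wt q u N t).toReal := fun t ht => hl.trans_le (hlW t ht)
  have hWr : ∀ t, Wt q u N t = ENNReal.ofReal (Wt q u N t).toReal :=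
    fun t => (ENNReal.ofReal_toReal (hWfin t)).symm
  have hFm : Measurable (fun x : ℝ × (ℝ × ℝ) => Ft p q u N l x.1 x.2) := by
    unfold Ft
    refine Measurable.indicator ?_ ((St_meas hum N l).prod (measurableSet_bx N))
    refine (Complex.continuous_conj.measurable.comp hum).mul ?_
    refine Complex.measurable_ofReal.comp ?_
    exact (hum.norm.pow_const _).mul
      (((Wt_meas hum N).comp measurable_fst).ennreal_toReal.pow_const _)
  have hsupp : ∀ t z, Ft p q u N l t z ≠ 0 → t ∈ St q u N l ∧ z ∈ bx N := by
    intro t z h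
    exact mem_of_indicator_ne_zero (s := St q u N l ×ˢ bx N) (a := (t, z)) h
  have hFb : ∀ t z, ‖Ft p q u N l t z‖ ≤ B ^ (q - 1) * (l ^ (p / q - 1) + L ^ (p / q - 1)) := by
    intro t z
    have hL0 : 0 ≤ L := ENNReal.toReal_nonneg
    by_cases h : Ft p q u N l t z = 0
    · rw [h, norm_zero]; positivity
    · obtain ⟨ht, hz⟩ := hsupp t z h
      rw [norm_Ft (by linarith) ht hz]
      have := rpow_between (a := p / q - 1) hl (hlW t ht) (hWL t)
      have h3 := hB t z
      have hq1 : 0 ≤ q - 1 := by linarith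
      gcongr
  have hpair := pairing hp hq hpq hg hgm hFm hFb (fun t z h => ⟨(hsupp t z h).1.1, (hsupp t z h).2⟩)
  set X := ∫⁻ t in St q u N l, Wt q u N t ^ (p / q) with hX
  have hp0 : 0 < p := by linarith
  have hq0 : 0 < q := by linarith
  have hp1 : 0 < p - 1 := by linarith
  have hq1 : 0 < q - 1 := by linarith
  -- the dual norm
  have hdual : ∫⁻ t, ((∫⁻ z, ‖Ft p q u N l t z‖ₑ ^ (q / (q - 1))) ^ ((q - 1) / q)) ^ (p / (p - 1)) = X := by
    rw [hX, ← lintegral_indicator (St_meas hum N l)]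
    congr 1; ext t
    by_cases ht : t ∈ St q u N l
    · rw [indicator_of_mem ht]
      have hw := hpos t ht
      have e1 : ∫⁻ z, ‖Ft p q u N l t z‖ₑ ^ (q / (q - 1)) =
          ENNReal.ofReal ((Wt q u N t).toReal ^ ((p / q - 1) * (q / (q - 1)))) * Wt q u N t := by
        rw [Wt, ← lintegral_const_mul' _ _ ENNReal.ofReal_ne_top, ← Wt,
          ← lintegral_indicator (measurableSet_bx N)]
        congr 1; ext z
        by_cases hz : z ∈ bx N
        · rw [indicator_of_mem hz, enorm_rpow_eq _ (by positivity), enorm_rpow_eq _ hq0.le,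
            norm_Ft (by linarith) ht hz, ← ENNReal.ofReal_mul (by positivity),
            Real.mul_rpow (by positivity) (by positivity), ← Real.rpow_mul (norm_nonneg _),
            ← Real.rpow_mul hw.le, mul_comm]
          congr 3; field_simp
        · rw [indicator_of_notMem hz]
          have : Ft p q u N l t z = 0 := by by_contra h; exact hz (hsupp t z h).2
          rw [this, enorm_zero, ENNReal.zero_rpow_of_pos (by positivity)]
      have hWw := hWr t
      rw [e1]
      generalize (Wt q u N t).toReal = w at hw hWw ⊢
      rw [hWw, ← ENNReal.ofReal_mul (by positivity), ← Real.rpow_add_one hw.ne',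
        ENNReal.ofReal_rpow_of_pos (by positivity), ENNReal.ofReal_rpow_of_pos (by positivity),
        ENNReal.ofReal_rpow_of_pos hw, ← Real.rpow_mul hw.le, ← Real.rpow_mul hw.le]
      congr 2; field_simp; ring
    · rw [indicator_of_notMem ht]
      have : ∀ z, Ft p q u N l t z = 0 := by intro z; by_contra h; exact ht (hsupp t z h).1
      simp only [this, enorm_zero]
      rw [ENNReal.zero_rpow_of_pos (by positivity), lintegral_zero,
        ENNReal.zero_rpow_of_pos (by positivity), ENNReal.zero_rpow_of_pos (by positivity)]
  -- the pairing
  have hms : MeasurableSet (Ioc (-N) N ×ˢ bx N) := measurableSet_Ioc.prod (measurableSet_bx N)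
  have hfin : volume (Ioc (-N) N ×ˢ bx N) ≠ ⊤ := by
    rw [Measure.volume_eq_prod, Measure.prod_prod]
    exact (ENNReal.mul_lt_top (by simp) (volume_bx_lt_top N)).ne
  have huF : ∀ t z, u t z * Ft p q u N l t z = (‖u t z * Ft p q u N l t z‖ : ℂ) := by
    intro t z
    by_cases h : Ft p q u N l t z = 0
    · rw [h]; simp
    · obtain ⟨ht, hz⟩ := hsupp t z h
      have : u t z * Ft p q u N l t z =
          ((‖u t z‖ ^ 2 * (‖u t z‖ ^ (q - 2) * (Wt q u N t).toReal ^ (p / q - 1)) : ℝ) : ℂ) := by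
        unfold Ft
        rw [indicator_of_mem (show (t, z) ∈ St q u N l ×ˢ bx N from ⟨ht, hz⟩), ← mul_assoc,
          Complex.mul_conj, Complex.normSq_eq_norm_sq, ← Complex.ofReal_mul]
      rw [this, Complex.norm_real, Real.norm_of_nonneg (by positivity)]
  have hpi : Integrable (fun x : ℝ × (ℝ × ℝ) => u x.1 x.2 * Ft p q u N l x.1 x.2) := by
    set M := B * (B ^ (q - 1) * (l ^ (p / q - 1) + L ^ (p / q - 1))) with hMdef
    have hMb : ∀ t z, ‖u t z * Ft p q u N l t z‖ ≤ M := by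
      intro t z; rw [norm_mul]
      exact mul_le_mul (hB t z) (hFb t z) (norm_nonneg _) hB0
    have hci : Integrable ((Ioc (-N) N ×ˢ bx N).indicator (fun _ => M)) :=
      (integrable_indicator_iff hms).2 (integrableOn_const hfin)
    refine hci.mono' (hum.mul hFm).aestronglyMeasurable (Filter.Eventually.of_forall fun x => ?_)
    by_cases h : Ft p q u N l x.1 x.2 = 0
    · rw [h, mul_zero, norm_zero]
      exact indicator_nonneg (fun _ _ => (norm_nonneg _).trans (hMb 0 0)) x
    · rw [indicator_of_mem (show x ∈ Ioc (-N) N ×ˢ bx N from ⟨(hsupp _ _ h).1.1, (hsupp _ _ h).2⟩)]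
      exact hMb _ _
  have hleft : ‖∫ x : ℝ × (ℝ × ℝ), u x.1 x.2 * Ft p q u N l x.1 x.2‖ₑ = X := by
    rw [enorm_integral_nonneg hpi (fun x => huF x.1 x.2), Measure.volume_eq_prod,
      lintegral_prod (fun x : ℝ × (ℝ × ℝ) => ‖u x.1 x.2 * Ft p q u N l x.1 x.2‖ₑ)
        (hum.mul hFm).enorm.aemeasurable, hX, ← lintegral_indicator (St_meas hum N l)]
    congr 1; ext t
    by_cases ht : t ∈ St q u N l
    · rw [indicator_of_mem ht]
      have hw := hpos t ht
      have e1 : ∫⁻ z, ‖u t z * Ft p q u N l t z‖ₑ =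
          ENNReal.ofReal ((Wt q u N t).toReal ^ (p / q - 1)) * Wt q u N t := by
        rw [Wt, ← lintegral_const_mul' _ _ ENNReal.ofReal_ne_top, ← Wt,
          ← lintegral_indicator (measurableSet_bx N)]
        congr 1; ext z
        by_cases hz : z ∈ bx N
        · rw [indicator_of_mem hz, enorm_rpow_eq _ hq0.le, ← ofReal_norm, norm_mul,
            norm_Ft (by linarith) ht hz, ← ENNReal.ofReal_mul (by positivity)]
          congr 1
          have : ‖u t z‖ * ‖u t z‖ ^ (q - 1) = ‖u t z‖ ^ q := by
            have := rpow_split (norm_nonneg (u t z)) (q := q + 1) (by linarith)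
            rw [show q + 1 - 2 = q - 1 by ring, show q + 1 - 1 = q by ring] at this
            exact this
          rw [← this]; ring
        · rw [indicator_of_notMem hz]
          have : Ft p q u N l t z = 0 := by by_contra h; exact hz (hsupp t z h).2
          rw [this, mul_zero, enorm_zero]
      simp only at e1 ⊢
      have hWw := hWr t
      rw [e1]
      generalize (Wt q u N t).toReal = w at hw hWw ⊢
      rw [hWw, ← ENNReal.ofReal_mul (by positivity), ← Real.rpow_add_one hw.ne',
        ENNReal.ofReal_rpow_of_pos hw]
      congr 2; ring
    · rw [indicator_of_notMem ht]
      have : ∀ z, Ft p q u N l t z = 0 := by intro z; by_contra h; exact ht (hsupp t z h).1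
      simp [this]
  have hXfin : X ≠ ⊤ := by
    rw [← hleft]; exact enorm_ne_top
  have hpair' : X ≤ (∫⁻ ζ, ‖g ζ‖ₑ ^ 2) ^ (1 / 2 : ℝ) * (ENNReal.ofReal (CB p q * (2 * CH p)) *
        X ^ (2 * ((p - 1) / p))) ^ (1 / 2 : ℝ) := by
    rw [hdual] at hpair
    refine le_trans (le_of_eq hleft.symm) ?_
    rw [hu] at *
    exact hpair
  set A := (∫⁻ ζ, ‖g ζ‖ₑ ^ 2) ^ (1 / 2 : ℝ)
  set K := ENNReal.ofReal (CB p q * (2 * CH p))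
  rw [ENNReal.mul_rpow_of_nonneg _ _ (by norm_num : (0:ℝ) ≤ 1 / 2), ← ENNReal.rpow_mul, ← mul_assoc,
    show 2 * ((p - 1) / p) * (1 / 2) = (p - 1) / p by ring] at hpair'
  rcases eq_or_ne X 0 with h0 | h0
  · rw [h0]; exact zero_le
  have hX1 : X ^ (1 / p) ≤ A * K ^ (1 / 2 : ℝ) := by
    have : X ^ (1 / p) = X / X ^ ((p - 1) / p) := by
      nth_rewrite 2 [← ENNReal.rpow_one X]
      rw [← ENNReal.rpow_sub _ _ h0 hXfin]
      congr 1; field_simp; ring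
    rw [this]
    exact ENNReal.div_le_of_le_mul hpair'
  calc X = (X ^ (1 / p)) ^ p := by
        rw [← ENNReal.rpow_mul, one_div_mul_cancel hp0.ne', ENNReal.rpow_one]
    _ ≤ _ := by gcongr

lemma full_bound {p q : ℝ} (hp : 3 < p) (hq : 2 < q) (hpq : 3 / p + 2 / q = 1)
    {g : ℝ × ℝ → ℂ} (hg : Integrable g) (hgm : Measurable g)
    {u : ℝ → ℝ × ℝ → ℂ} (hu : u = fun t => IFT2 (fun ζ => om t ζ * g ζ)) :
    ∫⁻ t, (∫⁻ z, ‖u t z‖ₑ ^ q) ^ (p / q) ≤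
      ((∫⁻ ζ, ‖g ζ‖ₑ ^ 2) ^ (1 / 2 : ℝ) *
        ENNReal.ofReal (CB p q * (2 * CH p)) ^ (1 / 2 : ℝ)) ^ p := by
  have hum : Measurable (fun x : ℝ × (ℝ × ℝ) => u x.1 x.2) := by rw [hu]; exact uu_meas hgm
  have hpq0 : 0 < p / q := div_pos (by linarith) (by linarith)
  set f : ℕ → ℝ → ℝ≥0∞ := fun n t =>
    (St q u n (1 / ((n : ℝ) + 1))).indicator (fun t => Wt q u n t ^ (p / q)) t with hf
  have hfm : ∀ n, Measurable (f n) := fun n =>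
    ((Wt_meas hum n).pow_const _).indicator (St_meas hum _ _)
  have hmono : Monotone (fun n : ℕ => bx (n : ℝ)) := by
    intro a b hab
    have : (a : ℝ) ≤ b := by exact_mod_cast hab
    exact prod_mono (Ioc_subset_Ioc (by linarith) this) (Ioc_subset_Ioc (by linarith) this)
  have hun : ⋃ n : ℕ, bx (n : ℝ) = univ := by
    ext ⟨x, y⟩
    simp only [mem_iUnion, mem_univ, iff_true]
    obtain ⟨n, hn⟩ := exists_nat_gt (max |x| |y|)
    have h1 := abs_lt.1 ((le_max_left _ _).trans_lt hn)
    have h2 := abs_lt.1 ((le_max_right _ _).trans_lt hn)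
    exact ⟨n, ⟨h1.1, h1.2.le⟩, ⟨h2.1, h2.2.le⟩⟩
  have hW : ∀ t, Filter.Tendsto (fun n : ℕ => Wt q u n t) Filter.atTop
      (nhds (∫⁻ z, ‖u t z‖ₑ ^ q)) := by
    intro t
    rw [← setLIntegral_univ, ← hun, setLIntegral_iUnion_of_directed _ hmono.directed_le]
    exact tendsto_atTop_iSup (fun a b hab => lintegral_mono_set (hmono hab))
  have hlim : ∀ t, (∫⁻ z, ‖u t z‖ₑ ^ q) ^ (p / q) ≤ Filter.liminf (fun n => f n t) Filter.atTop := by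
    intro t
    rcases eq_or_ne (∫⁻ z, ‖u t z‖ₑ ^ q) 0 with h0 | h0
    · rw [h0, ENNReal.zero_rpow_of_pos hpq0]; exact zero_le
    have h1 : Filter.Tendsto (fun n : ℕ => ENNReal.ofReal (1 / ((n : ℝ) + 1))) Filter.atTop (nhds 0) := by
      have := ENNReal.tendsto_ofReal (tendsto_one_div_add_atTop_nhds_zero_nat (𝕜 := ℝ))
      rwa [ENNReal.ofReal_zero] at this
    have h2 := h1.eventually_lt (hW t) (pos_iff_ne_zero.2 h0)
    obtain ⟨k, hk⟩ := exists_nat_gt |t|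
    have h3 : (fun n : ℕ => Wt q u n t ^ (p / q)) =ᶠ[Filter.atTop] fun n => f n t := by
      filter_upwards [h2, Filter.eventually_ge_atTop k] with n hn hkn
      have hk' := abs_lt.1 (hk.trans_le (by exact_mod_cast hkn : (k : ℝ) ≤ n))
      simp only [hf]
      rw [indicator_of_mem (show t ∈ St q u n (1 / ((n : ℝ) + 1)) from ⟨⟨hk'.1, hk'.2.le⟩, hn⟩)]
    have h4 := ((ENNReal.continuous_rpow_const (y := p / q)).tendsto _).comp (hW t)
    exact (h4.congr' h3).liminf_eq.ge
  calc _ ≤ ∫⁻ t, Filter.liminf (fun n => f n t) Filter.atTop := lintegral_mono hlim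
    _ ≤ Filter.liminf (fun n => ∫⁻ t, f n t) Filter.atTop := lintegral_liminf_le hfm
    _ ≤ _ := by
      refine Filter.liminf_le_of_le (by isBoundedDefault) ?_
      intro b hb
      obtain ⟨n, hn⟩ := hb.exists
      refine hn.trans ?_
      simp only [hf]
      rw [lintegral_indicator (St_meas hum _ _)]
      exact trunc_bound hp hq hpq hg hgm (by positivity) hu

lemma IFT2_undef {f : ℝ × ℝ → ℂ} (hf : ¬ Integrable f) (z : ℝ × ℝ) : IFT2 f z = 0 := by
  rw [IFT2_eq]
  apply integral_undef
  intro h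
  apply hf
  have := integrable_ee_mul h (-z)
  refine this.congr (Filter.Eventually.of_forall fun q => ?_)
  simp only
  rw [← mul_assoc, ee_neg, ← Complex.normSq_eq_conj_mul_self, Complex.normSq_eq_norm_sq, norm_ee]
  simp

lemma om_int {t : ℝ} {f : ℝ × ℝ → ℂ} (h : Integrable fun ζ => om t ζ * f ζ) : Integrable f := by
  have := h.bdd_mul (c := 1) (f := fun ζ => starRingEnd ℂ (om t ζ))
    (Complex.continuous_conj.comp (continuous_om_right t)).aestronglyMeasurable
    (Filter.Eventually.of_forall fun y => by rw [RCLike.norm_conj, norm_om])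
  refine this.congr (Filter.Eventually.of_forall fun ζ => ?_)
  simp only
  rw [← mul_assoc, ← Complex.normSq_eq_conj_mul_self, Complex.normSq_eq_norm_sq, norm_om]
  simp

/-- the Strichartz type estimate `‖U(t)φ‖_{L^p_t L^q_{x,y}} ≲ ‖φ‖_{L²}`
for `3/p + 2/q = 1`, `p > 3`. -/
theorem strichartz_free_2 (p q : ℝ) (hp : 3 < p) (hpq : 3 / p + 2 / q = 1) :
    ∃ C : ℝ≥0, 0 < C ∧ ∀ φ : ℝ × ℝ → ℂ, L2N2 φ ≠ ⊤ →
      LpLq p q (fun r => Ugrp r.1 φ (r.2.1, r.2.2)) ≤ (C : ℝ≥0∞) * L2N2 φ := by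
  have hp0 : 0 < p := by linarith
  have h3p : 3 / p < 1 := by rw [div_lt_one hp0]; exact hp
  have h3p0 : 0 < 3 / p := by positivity
  have hq0 : 0 < q := by
    by_contra h
    have : 2 / q ≤ 0 := div_nonpos_of_nonneg_of_nonpos (by norm_num) (not_lt.1 h)
    linarith
  have hq : 2 < q := by
    have : 2 / q < 1 := by linarith
    rwa [div_lt_one hq0] at this
  have hpq0 : 0 < p / q := by positivity
  have hK : 0 < CB p q * (2 * CH p) := by
    have h1 : 0 < q - 2 := by linarith
    have h2 : 0 < 1 - 2 / p := by
      have : 2 / p < 1 := by rw [div_lt_one hp0]; linarith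
      linarith
    unfold CB CH
    positivity
  set K := CB p q * (2 * CH p) with hKdef
  refine ⟨(K ^ (1 / 2 : ℝ)).toNNReal, Real.toNNReal_pos.2 (by positivity), fun φ _ => ?_⟩
  have hCe : (((K ^ (1 / 2 : ℝ)).toNNReal : ℝ≥0) : ℝ≥0∞) = ENNReal.ofReal K ^ (1 / 2 : ℝ) := by
    rw [ENNReal.ofReal_rpow_of_pos hK]; rfl
  rw [hCe]
  have hU : ∀ t z, Ugrp t φ z = IFT2 (fun ζ => om t ζ * FT2 φ ζ) z := fun t z => rfl
  have hLp : LpLq p q (fun r => Ugrp r.1 φ (r.2.1, r.2.2)) =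
      (∫⁻ t, (∫⁻ z, ‖IFT2 (fun ζ => om t ζ * FT2 φ ζ) z‖ₑ ^ q) ^ (p / q)) ^ (1 / p) := rfl
  rw [hLp]
  by_cases hi : Integrable (FT2 φ)
  swap
  · have : ∀ t z, IFT2 (fun ζ => om t ζ * FT2 φ ζ) z = 0 := fun t z =>
      IFT2_undef (fun h => hi (om_int h)) z
    simp only [this, enorm_zero]
    rw [ENNReal.zero_rpow_of_pos hq0, lintegral_zero, ENNReal.zero_rpow_of_pos hpq0, lintegral_zero,
      ENNReal.zero_rpow_of_pos (by positivity)]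
    exact zero_le
  by_cases hφ : Integrable φ
  swap
  · have h0 : ∀ ζ, FT2 φ ζ = 0 := fun ζ => by rw [FT2_eq_IFT2]; exact IFT2_undef hφ _
    have : ∀ t z, IFT2 (fun ζ => om t ζ * FT2 φ ζ) z = 0 := fun t z => by
      rw [IFT2_eq]; simp [h0]
    simp only [this, enorm_zero]
    rw [ENNReal.zero_rpow_of_pos hq0, lintegral_zero, ENNReal.zero_rpow_of_pos hpq0, lintegral_zero,
      ENNReal.zero_rpow_of_pos (by positivity)]
    exact zero_le
  have key := full_bound hp hq hpq hi (continuous_FT2 hφ).measurable rfl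
  have hL2 : L2N2 φ = (∫⁻ z, ‖φ z‖ₑ ^ 2) ^ (1 / 2 : ℝ) := rfl
  calc _ ≤ (((∫⁻ ζ, ‖FT2 φ ζ‖ₑ ^ 2) ^ (1 / 2 : ℝ) *
        ENNReal.ofReal K ^ (1 / 2 : ℝ)) ^ p) ^ (1 / p) := by
        gcongr
    _ = ENNReal.ofReal K ^ (1 / 2 : ℝ) * (∫⁻ ζ, ‖FT2 φ ζ‖ₑ ^ 2) ^ (1 / 2 : ℝ) := by
        rw [← ENNReal.rpow_mul, mul_one_div_cancel hp0.ne', ENNReal.rpow_one, mul_comm]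
    _ ≤ _ := by
        rw [hL2]
        exact mul_le_mul_right (ENNReal.rpow_le_rpow (planch_FT2 hφ) (by norm_num)) _

end
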